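/- arXiv:1804.01960 — 3 statements merged into one kernel-verified Lean document; each statement's English description precedes it below -/
import Mathlib

section
/- There is a constant C depending only on the dimension N such that the following holds. Let K ≥ 0 and let f : ℝ^N → ℝ be smooth with ∇²f(v,v) ≥ −(N−1)K|v|² for all vectors v. Fix x₀ ∈ ℝ^N, R ≥ 2, t₀ ∈ ℝ, T > 0, and set Q_{R,T} := B̄(x₀,R) × [t₀−T, t₀]. Let q be a smooth function on ℝ^N × ℝ, let α ≥ 1 be real, and let u be a smooth positive solution of ∂ₜu = Δ_f u + q·u^α on Q_{R,T} with u ≤ D there, for some constant D > 0. Set β := sup_{Q_{R/2,T}} |ln(u/D)| + 1 and μ := max_{|x−x₀|=1} ((N−1) − ⟨∇f(x), x−x₀⟩). Then for all (x,t) ∈ Q_{R/2,T} with t ≠ t₀−T: |∇u(x,t)|/u(x,t) ≤ C·( √((1+|μ|)/R) + 1/√(t−(t₀−T)) + √K + √α·D^{(α−1)/2}·(sup_{Q_{R,T}} q⁺)^{1/2} + D^{(α−1)/3}·(sup_{Q_{R,T}} |∇q|)^{1/3} )·( β + ln(D/u(x,t)) ). -/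
open Real Set Metric Filter
open scoped RealInnerProductSpace Topology

noncomputable section

/-- The Hessian of `f : ℝ^N → ℝ` at `x`, evaluated on the pair of vectors `(v, w)`. -/
def hess {N : ℕ} (f : EuclideanSpace ℝ (Fin N) → ℝ) (x v w : EuclideanSpace ℝ (Fin N)) : ℝ :=
  ⟪fderiv ℝ (gradient f) x v, w⟫

/-- The Laplacian of `f : ℝ^N → ℝ` at `x` (trace of the Hessian). -/
def lap {N : ℕ} (f : EuclideanSpace ℝ (Fin N) → ℝ) (x : EuclideanSpace ℝ (Fin N)) : ℝ :=
  ∑ i, hess f x (EuclideanSpace.single i 1) (EuclideanSpace.single i 1)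

/-- The weighted (drift) Laplacian `Δ_f u = Δ u − ⟨∇f, ∇u⟩`. -/
def wlap {N : ℕ} (f u : EuclideanSpace ℝ (Fin N) → ℝ) (x : EuclideanSpace ℝ (Fin N)) : ℝ :=
  lap u x - ⟪gradient f x, gradient u x⟫

/-- Spatial gradient of a space-time function. -/
def sgrad {N : ℕ} (u : EuclideanSpace ℝ (Fin N) × ℝ → ℝ) (p : EuclideanSpace ℝ (Fin N) × ℝ) :
    EuclideanSpace ℝ (Fin N) :=
  gradient (fun y => u (y, p.2)) p.1

/-- Spatial weighted Laplacian `Δ_f u(·,t)` of a space-time function. -/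
def swlap {N : ℕ} (f : EuclideanSpace ℝ (Fin N) → ℝ) (u : EuclideanSpace ℝ (Fin N) × ℝ → ℝ)
    (p : EuclideanSpace ℝ (Fin N) × ℝ) : ℝ :=
  wlap f (fun y => u (y, p.2)) p.1

/-- Time derivative `∂ₜ u` of a space-time function. -/
def tderiv {N : ℕ} (u : EuclideanSpace ℝ (Fin N) × ℝ → ℝ) (p : EuclideanSpace ℝ (Fin N) × ℝ) : ℝ :=
  deriv (fun s => u (p.1, s)) p.2

/-- The parabolic cylinder `Q_{R,T} = B̄(x₀,R) × [t₀ − T, t₀]`. -/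
def cyl {N : ℕ} (x₀ : EuclideanSpace ℝ (Fin N)) (R t₀ T : ℝ) :
    Set (EuclideanSpace ℝ (Fin N) × ℝ) :=
  (closedBall x₀ R) ×ˢ (Icc (t₀ - T) t₀)

/-- `μ := max_{|x−x₀|=1} ((N−1) − ⟨∇f(x), x−x₀⟩)`. -/
def muConst {N : ℕ} (f : EuclideanSpace ℝ (Fin N) → ℝ) (x₀ : EuclideanSpace ℝ (Fin N)) : ℝ :=
  sSup ((fun x => ((N : ℝ) - 1) - ⟪gradient f x, x - x₀⟫) '' sphere x₀ 1)


namespace EGE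

lemma root_bound {z k A b m : ℝ} (hz : 0 ≤ z) (hm : 0 ≤ m) (hk : k ≤ m)
    (hA : A ≤ m ^ 2) (hb : b ≤ m ^ 3) (h : z ^ 3 ≤ k * z ^ 2 + A * z + b) : z ≤ 3 * m := by
  by_contra hc
  push Not at hc
  have h1 : k * z ^ 2 ≤ m * z ^ 2 := by gcongr
  have h2 : A * z ≤ m ^ 2 * z := by gcongr
  have hz0 : 0 < z := by linarith
  have e1 : m * z ^ 2 ≤ (z / 3) * z ^ 2 := by gcongr; linarith
  have e2 : m ^ 2 * z ≤ (z / 3) ^ 2 * z := by gcongr; linarith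
  have e3 : m ^ 3 ≤ (z / 3) ^ 3 := by gcongr; linarith
  have : 0 < z ^ 3 := by positivity
  nlinarith

set_option maxHeartbeats 1000000 in
lemma alg_scalar {w ψ g s k L κ A1 b0 Q1 Q2 Q3 Q4 Q5 Q6 Q7 Q8 Q9 P : ℝ}
    (hψ : 0 < ψ) (hψ1 : ψ ≤ 1) (hw : 0 < w) (hg : 1 ≤ g) (hs : 0 < s) (hk : 0 ≤ k)
    (hκ : 0 ≤ κ) (hA : 0 ≤ A1) (hb : 0 ≤ b0) (hL : 0 ≤ L)
    (e2 : 2 * ψ * Q2 = -(w * Q9)) (e4 : 2 * ψ * Q4 = -(w * Q7)) (e6 : 2 * ψ * Q6 = -(w * Q8))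
    (h2 : w * P + 4 * Q6 + 2 * ψ * Q1 ≤ 0)
    (h3 : 0 ≤ w + s * (2 * (Q1 + 2 * (1 - g) * Q2 - g * w ^ 2 - Q3 - Q4 - Q5)))
    (h4 : -(κ * w) ≤ Q3) (h5 : -(A1 * w + b0 * √w) ≤ Q5)
    (h6 : Q8 ≤ k ^ 2 * ψ) (h7 : -L ≤ P - Q7) (h9 : Q9 ^ 2 ≤ w * Q8) :
    √(ψ * w) ^ 3 ≤ k * √(ψ * w) ^ 2 + (L / 2 + k ^ 2 + 1 / (2 * s) + κ + A1) * √(ψ * w) + b0 := by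
  set z := √(ψ * w) with hz
  have hzz : z ^ 2 = ψ * w := Real.sq_sqrt (by positivity)
  have hzp : 0 < z := Real.sqrt_pos.2 (by positivity)
  -- bound for Q9
  have hQ9 : |Q9| ≤ k * z := by
    apply abs_le_of_sq_le_sq _ (by positivity)
    calc Q9 ^ 2 ≤ w * Q8 := h9
      _ ≤ w * (k ^ 2 * ψ) := by gcongr
      _ = (k * z) ^ 2 := by rw [mul_pow, hzz]; ring
  have hQ9' : -(k * z) ≤ Q9 ∧ Q9 ≤ k * z := abs_le.1 hQ9
  -- sqrt bound
  have hsw : ψ * (ψ * √w) ≤ z := by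
    rw [hz, Real.sqrt_mul hψ.le]
    have h1 : ψ * ψ ≤ √ψ := by
      have : ψ ≤ √ψ := by
        apply Real.le_sqrt_of_sq_le; nlinarith
      nlinarith
    have := mul_le_mul_of_nonneg_right h1 (Real.sqrt_nonneg w)
    linarith
  have h3' : 0 ≤ w / s + 2 * (Q1 + 2 * (1 - g) * Q2 - g * w ^ 2 - Q3 - Q4 - Q5) := by
    have : w / s + 2 * (Q1 + 2 * (1 - g) * Q2 - g * w ^ 2 - Q3 - Q4 - Q5)
      = (w + s * (2 * (Q1 + 2 * (1 - g) * Q2 - g * w ^ 2 - Q3 - Q4 - Q5))) / s := by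
      field_simp
    rw [this]; positivity
  -- multiply by ψ
  have h3'' := mul_nonneg (mul_nonneg hψ.le hψ.le) h3'
  have h2' := mul_nonneg_of_nonpos_of_nonpos (neg_nonpos.2 hψ.le) h2
  have key : 2 * g * z ^ 4 ≤ z ^ 2 * (Q7 - P) + 2 * w * Q8 + ψ * (z ^ 2 / s)
      + 2 * (g - 1) * z ^ 2 * Q9 - 2 * ψ ^ 2 * Q3 - 2 * ψ ^ 2 * Q5 := by
    have hz4 : z ^ 4 = ψ ^ 2 * w ^ 2 := by rw [show z ^ 4 = (z ^ 2) ^ 2 by ring, hzz]; ring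
    rw [hz4, hzz]
    have a1 : ψ * ψ * (w / s + 2 * (Q1 + 2 * (1 - g) * Q2 - g * w ^ 2 - Q3 - Q4 - Q5))
      = ψ * (ψ * w / s) + ψ * (2 * ψ * Q1) + 2 * ψ * (1 - g) * (2 * ψ * Q2)
        - 2 * g * (ψ ^ 2 * w ^ 2) - 2 * ψ ^ 2 * Q3 - ψ * (2 * ψ * Q4) - 2 * ψ ^ 2 * Q5 := by ring
    rw [a1, e2, e4] at h3''
    have a2 : -ψ * (w * P + 4 * Q6 + 2 * ψ * Q1) = -ψ * w * P - 2 * (2 * ψ * Q6) - ψ * (2 * ψ * Q1) := by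
      ring
    rw [a2, e6] at h2'
    linarith
  have b1 : z ^ 2 * (Q7 - P) ≤ z ^ 2 * L := by gcongr; linarith
  have b2 : 2 * w * Q8 ≤ 2 * z ^ 2 * k ^ 2 := by
    calc 2 * w * Q8 ≤ 2 * w * (k ^ 2 * ψ) := by gcongr
      _ = _ := by rw [hzz]; ring
  have b3 : ψ * (z ^ 2 / s) ≤ z ^ 2 / s := by
    have : 0 ≤ z ^ 2 / s := by positivity
    nlinarith
  have b4 : 2 * (g - 1) * z ^ 2 * Q9 ≤ 2 * g * z ^ 2 * (k * z) := by
    have : 2 * (g - 1) * z ^ 2 * Q9 ≤ 2 * (g - 1) * z ^ 2 * (k * z) := by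
      have : 0 ≤ 2 * (g - 1) * z ^ 2 := by
        have : 0 ≤ g - 1 := by linarith
        positivity
      exact mul_le_mul_of_nonneg_left hQ9'.2 this
    have : 0 ≤ z ^ 2 * (k * z) := by positivity
    linarith
  have b5 : - 2 * ψ ^ 2 * Q3 ≤ 2 * κ * z ^ 2 := by
    have : -Q3 ≤ κ * w := by linarith
    have h := mul_le_mul_of_nonneg_left this (show 0 ≤ 2 * ψ ^ 2 by positivity)
    have h' : 2 * ψ ^ 2 * (κ * w) ≤ 2 * κ * z ^ 2 := by
      rw [hzz]
      have : 0 ≤ κ * (ψ * w) := by positivity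
      have := mul_le_mul_of_nonneg_right hψ1 this
      linarith
    linarith
  have b6 : - 2 * ψ ^ 2 * Q5 ≤ 2 * A1 * z ^ 2 + 2 * b0 * z := by
    have : -Q5 ≤ A1 * w + b0 * √w := by linarith
    have h := mul_le_mul_of_nonneg_left this (show 0 ≤ 2 * ψ ^ 2 by positivity)
    have h' : 2 * ψ ^ 2 * (A1 * w) ≤ 2 * A1 * z ^ 2 := by
      rw [hzz]
      have : 0 ≤ A1 * (ψ * w) := by positivity
      have := mul_le_mul_of_nonneg_right hψ1 this
      linarith
    have h'' := mul_le_mul_of_nonneg_left hsw (show 0 ≤ 2 * b0 by positivity)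
    linarith
  have fin1 : 2 * g * z ^ 4 ≤ 2 * g * (z * (k * z ^ 2 + (L / 2 + k ^ 2 + 1 / (2 * s) + κ + A1) * z + b0)) := by
    have hX : 0 ≤ z * ((L / 2 + k ^ 2 + 1 / (2 * s) + κ + A1) * z + b0) := by positivity
    have e : z ^ 2 / s = 2 * z ^ 2 * (1 / (2 * s)) := by field_simp
    rw [e] at b3 key
    have : 2 * (z * ((L / 2 + k ^ 2 + 1 / (2 * s) + κ + A1) * z + b0)) ≤
      2 * g * (z * ((L / 2 + k ^ 2 + 1 / (2 * s) + κ + A1) * z + b0)) := by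
      have := mul_le_mul_of_nonneg_right hg hX
      linarith
    linarith
  have fin2 : z * z ^ 3 ≤ z * (k * z ^ 2 + (L / 2 + k ^ 2 + 1 / (2 * s) + κ + A1) * z + b0) := by
    have := le_of_mul_le_mul_left fin1 (show 0 < 2 * g by linarith)
    linarith [show z * z ^ 3 = z ^ 4 by ring]
  exact le_of_mul_le_mul_left fin2 hzp

lemma alg {N : ℕ} {a p pp m d H : Fin N → ℝ} {b c h : Fin N → Fin N → ℝ}
    {w ψ g s k L κ A1 b0 : ℝ}
    (hψ : 0 < ψ) (hψ1 : ψ ≤ 1) (hw : 0 < w) (hg : 1 ≤ g) (hs : 0 < s) (hk : 0 ≤ k)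
    (hκ : 0 ≤ κ) (hA : 0 ≤ A1) (hb : 0 ≤ b0) (hL : 0 ≤ L)
    (hwa : w = ∑ i, a i ^ 2)
    (hd : ∀ j, d j = ∑ i, (c i j + 2 * a i * b i j - g * a j * a i ^ 2 - 2 * g * a i * b i j)
      - ∑ i, h i j * a i - ∑ i, m i * b i j - H j)
    (h1 : ∀ i, p i * w + ψ * (2 * ∑ j, a j * b i j) = 0)
    (h2 : ∀ i, pp i * w + 2 * (p i * (2 * ∑ j, a j * b i j))
      + ψ * (2 * ∑ j, (b i j ^ 2 + a j * c i j)) ≤ 0)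
    (h3 : 0 ≤ w + s * (2 * ∑ j, a j * d j))
    (h4 : -(κ * w) ≤ ∑ i, ∑ j, h i j * a i * a j) (h5 : -(A1 * w + b0 * √w) ≤ ∑ j, a j * H j)
    (h6 : ∑ i, p i ^ 2 ≤ k ^ 2 * ψ) (h7 : -L ≤ ∑ i, pp i - ∑ i, m i * p i) :
    √(ψ * w) ^ 3 ≤ k * √(ψ * w) ^ 2 + (L / 2 + k ^ 2 + 1 / (2 * s) + κ + A1) * √(ψ * w) + b0 := by
  have hS : ∀ i, 2 * ψ * (∑ j, a j * b i j) = -(w * p i) := fun i => by linarith [h1 i]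
  have hsum : ∀ x : Fin N → ℝ, 2 * ψ * (∑ i, x i * ∑ j, a j * b i j) = -(w * ∑ i, x i * p i) := by
    intro x
    rw [Finset.mul_sum, Finset.mul_sum, ← Finset.sum_neg_distrib]
    refine Finset.sum_congr rfl fun i _ => ?_
    linear_combination x i * hS i
  refine alg_scalar (Q1 := ∑ j, a j * ∑ i, c i j) (Q2 := ∑ i, a i * ∑ j, a j * b i j)
    (Q3 := ∑ i, ∑ j, h i j * a i * a j) (Q4 := ∑ i, m i * ∑ j, a j * b i j)
    (Q5 := ∑ j, a j * H j) (Q6 := ∑ i, p i * ∑ j, a j * b i j) (Q7 := ∑ i, m i * p i)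
    (Q8 := ∑ i, p i ^ 2) (Q9 := ∑ i, a i * p i) (P := ∑ i, pp i)
    hψ hψ1 hw hg hs hk hκ hA hb hL (hsum a) (hsum m) ?_ ?_ ?_ h4 h5 h6 h7 ?_
  · rw [hsum p]; simp only [sq]
  · have := Finset.sum_nonpos (fun i (_ : i ∈ Finset.univ) => h2 i)
    have hB : 0 ≤ ψ * (2 * ∑ i, ∑ j, b i j ^ 2) := by positivity
    have e : ∑ j, a j * ∑ i, c i j = ∑ i, ∑ j, a j * c i j := by
      simp only [Finset.mul_sum]; rw [Finset.sum_comm]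
    rw [e]
    have e2 : ∑ i, (pp i * w + 2 * (p i * (2 * ∑ j, a j * b i j))
      + ψ * (2 * ∑ j, (b i j ^ 2 + a j * c i j))) = w * ∑ i, pp i + 4 * ∑ i, p i * ∑ j, a j * b i j
        + 2 * ψ * ∑ i, ∑ j, a j * c i j + ψ * (2 * ∑ i, ∑ j, b i j ^ 2) := by
      simp only [Finset.sum_add_distrib, Finset.mul_sum]
      have : ∀ i, 2 * (p i * ∑ i_1, 2 * (a i_1 * b i i_1)) = ∑ i_1, 4 * (p i * (a i_1 * b i i_1)) := by
        intro i; simp only [Finset.mul_sum]; refine Finset.sum_congr rfl fun j _ => by ring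
      simp only [← Finset.mul_sum, mul_add, Finset.sum_add_distrib]
      rw [← Finset.sum_mul]
      have : ∑ i, p i * (2 * ∑ j, a j * b i j) = 2 * ∑ i, p i * ∑ j, a j * b i j := by
        rw [Finset.mul_sum]; exact Finset.sum_congr rfl fun j _ => by ring
      rw [this]; ring
    linarith
  · have e : ∑ j, a j * d j = (∑ j, a j * ∑ i, c i j) + 2 * (1 - g) * (∑ i, a i * ∑ j, a j * b i j)
        - g * w ^ 2 - (∑ i, ∑ j, h i j * a i * a j) - (∑ i, m i * ∑ j, a j * b i j)
        - ∑ j, a j * H j := by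
      have s1 : ∑ i, a i * ∑ j, a j * b i j = ∑ j, a j * ∑ i, a i * b i j := by
        simp only [Finset.mul_sum]; rw [Finset.sum_comm]
        exact Finset.sum_congr rfl fun j _ => Finset.sum_congr rfl fun i _ => by ring
      have s2 : ∑ i, m i * ∑ j, a j * b i j = ∑ j, a j * ∑ i, m i * b i j := by
        simp only [Finset.mul_sum]; rw [Finset.sum_comm]
        exact Finset.sum_congr rfl fun j _ => Finset.sum_congr rfl fun i _ => by ring
      have s3 : ∑ i, ∑ j, h i j * a i * a j = ∑ j, a j * ∑ i, h i j * a i := by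
        simp only [Finset.mul_sum]; rw [Finset.sum_comm]
        exact Finset.sum_congr rfl fun j _ => Finset.sum_congr rfl fun i _ => by ring
      have s4 : g * w ^ 2 = ∑ j, g * w * a j ^ 2 := by
        rw [← Finset.mul_sum, ← hwa]; ring
      rw [s1, s2, s3, s4, Finset.mul_sum, ← Finset.sum_add_distrib, ← Finset.sum_sub_distrib,
        ← Finset.sum_sub_distrib, ← Finset.sum_sub_distrib, ← Finset.sum_sub_distrib]
      refine Finset.sum_congr rfl fun j _ => ?_
      have t : ∑ i, (c i j + 2 * a i * b i j - g * a j * a i ^ 2 - 2 * g * a i * b i j)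
        = ∑ i, c i j + 2 * (1 - g) * (∑ i, a i * b i j) - g * a j * w := by
        rw [hwa, Finset.mul_sum, Finset.mul_sum, ← Finset.sum_add_distrib, ← Finset.sum_sub_distrib]
        exact Finset.sum_congr rfl fun i _ => by ring
      rw [hd j, t]; ring
    rw [e] at h3
    exact h3
  · rw [hwa]; exact Finset.sum_mul_sq_le_sq_mul_sq _ _ _

/-- The cutoff profile. -/
lemma exists_cutoff : ∃ c : ℝ, 1 ≤ c ∧ ∃ θ : ℝ → ℝ, ContDiff ℝ (⊤ : ℕ∞) θ ∧
    (∀ x ≤ 1 / 4, θ x = 1) ∧ (∀ x, 1 ≤ x → θ x = 0) ∧ (∀ x, 0 ≤ θ x) ∧ (∀ x, θ x ≤ 1) ∧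
    (∀ x, deriv θ x ≤ 0) ∧ (∀ x ∈ Icc (0 : ℝ) 1, deriv θ x ^ 2 ≤ c * θ x) ∧
    (∀ x ∈ Icc (0 : ℝ) 1, |deriv θ x| ≤ c) ∧ (∀ x ∈ Icc (0 : ℝ) 1, |deriv (deriv θ) x| ≤ c) := by
  set η : ℝ → ℝ := fun x => Real.smoothTransition ((1 - x) * (4 / 3)) with hη
  have hηs : ContDiff ℝ (⊤ : ℕ∞) η := by
    apply Real.smoothTransition.contDiff.comp
    fun_prop
  have hηd : Differentiable ℝ η := hηs.differentiable (by simp)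
  have hθs : ContDiff ℝ (⊤ : ℕ∞) (fun x => η x ^ 2) := hηs.pow 2
  have hθ' : ContDiff ℝ (⊤ : ℕ∞) (deriv (fun x => η x ^ 2)) := by
    have := (contDiff_infty_iff_deriv.1 hθs).2
    exact this
  have hη' : Continuous (deriv η) := ((contDiff_infty_iff_deriv.1 hηs).2).continuous
  have hθ'' : Continuous (deriv (deriv (fun x => η x ^ 2))) :=
    ((contDiff_infty_iff_deriv.1 hθ').2).continuous
  obtain ⟨c1, hc1⟩ := (isCompact_Icc (a := (0 : ℝ)) (b := 1)).exists_bound_of_continuousOn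
    hη'.continuousOn
  obtain ⟨c2, hc2⟩ := (isCompact_Icc (a := (0 : ℝ)) (b := 1)).exists_bound_of_continuousOn
    hθ'.continuous.continuousOn
  obtain ⟨c3, hc3⟩ := (isCompact_Icc (a := (0 : ℝ)) (b := 1)).exists_bound_of_continuousOn
    hθ''.continuousOn
  have hanti : Antitone (fun x => η x ^ 2) := by
    intro x y hxy
    have : η y ≤ η x := Real.smoothTransition.monotone (by linarith)
    have h0 : 0 ≤ η y := Real.smoothTransition.nonneg _
    simp only
    gcongr
  have hder : ∀ x, deriv (fun x => η x ^ 2) x = 2 * η x * deriv η x := by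
    intro x
    have := ((hηd x).hasDerivAt.pow 2).deriv
    have e : (fun x => η x ^ 2) = η ^ 2 := rfl
    rw [e, this]; simp
  refine ⟨1 + 4 * c1 ^ 2 + |c2| + |c3|, ?_, fun x => η x ^ 2, hθs, ?_, ?_, ?_, ?_, ?_, ?_, ?_, ?_⟩
  · have := abs_nonneg c2; have := abs_nonneg c3; nlinarith [sq_nonneg c1]
  · intro x hx
    have : η x = 1 := Real.smoothTransition.one_of_one_le (by linarith)
    simp [this]
  · intro x hx
    have : η x = 0 := Real.smoothTransition.zero_of_nonpos (by linarith)
    simp [this]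
  · intro x; positivity
  · intro x
    have h0 : 0 ≤ η x := Real.smoothTransition.nonneg _
    have h1 : η x ≤ 1 := Real.smoothTransition.le_one _
    simp only
    nlinarith
  · intro x; exact hanti.deriv_nonpos
  · intro x hx
    have h := hc1 x hx
    rw [Real.norm_eq_abs] at h
    have h2 : deriv η x ^ 2 ≤ c1 ^ 2 := sq_le_sq' (by linarith [neg_le_of_abs_le h]) (le_of_abs_le h)
    rw [hder]
    have := abs_nonneg c2; have := abs_nonneg c3
    have h3 : (2 * η x * deriv η x) ^ 2 = 4 * (deriv η x ^ 2) * η x ^ 2 := by ring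
    rw [h3]
    have : 0 ≤ η x ^ 2 := by positivity
    simp only
    gcongr
    linarith
  · intro x hx
    have h := hc2 x hx
    rw [Real.norm_eq_abs] at h
    have := abs_nonneg c3; have := le_abs_self c2
    nlinarith [sq_nonneg c1]
  · intro x hx
    have h := hc3 x hx
    rw [Real.norm_eq_abs] at h
    have := abs_nonneg c2; have := le_abs_self c3
    nlinarith [sq_nonneg c1]


section toolkit
variable {X : Type*} [NormedAddCommGroup X] [NormedSpace ℝ X]

/-- directional derivative -/
def pd (v : X) (F : X → ℝ) : X → ℝ := fun p => fderiv ℝ F p v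

lemma pd_smooth {U : Set X} (hU : IsOpen U) {F : X → ℝ} (hF : ContDiffOn ℝ (⊤ : ℕ∞) F U) (v : X) :
    ContDiffOn ℝ (⊤ : ℕ∞) (pd v F) U :=
  (hF.fderiv_of_isOpen hU (by simp)).clm_apply contDiffOn_const

lemma sm_diff {U : Set X} (hU : IsOpen U) {F : X → ℝ} (hF : ContDiffOn ℝ (⊤ : ℕ∞) F U) {p : X}
    (hp : p ∈ U) : DifferentiableAt ℝ F p :=
  (hF.contDiffAt (hU.mem_nhds hp)).differentiableAt (by simp)

lemma hline' {F : X → ℝ} {p v : X} {ε : ℝ} (hF : DifferentiableAt ℝ F (p + ε • v)) :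
    HasDerivAt (fun ε : ℝ => F (p + ε • v)) (pd v F (p + ε • v)) ε := by
  have h1 : HasDerivAt (fun ε : ℝ => p + ε • v) v ε := by
    simpa using ((hasDerivAt_id ε).smul_const v).const_add p
  exact hF.hasFDerivAt.comp_hasDerivAt ε h1

lemma hline {F : X → ℝ} {p : X} (v : X) (hF : DifferentiableAt ℝ F p) :
    HasDerivAt (fun ε : ℝ => F (p + ε • v)) (pd v F p) 0 := by
  have := hline' (F := F) (p := p) (v := v) (ε := 0) (by simpa using hF)
  simpa using this

lemma pd_eq {F : X → ℝ} {p v : X} {d : ℝ} (hF : DifferentiableAt ℝ F p)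
    (h : HasDerivAt (fun ε : ℝ => F (p + ε • v)) d 0) : pd v F p = d :=
  (hline v hF).unique h

lemma pd_comm {U : Set X} (hU : IsOpen U) {F : X → ℝ} (hF : ContDiffOn ℝ (⊤ : ℕ∞) F U) {p : X}
    (hp : p ∈ U) (v w : X) : pd v (pd w F) p = pd w (pd v F) p := by
  have hs : IsSymmSndFDerivAt ℝ F p :=
    (hF.contDiffAt (hU.mem_nhds hp)).isSymmSndFDerivAt (by
      simp only [minSmoothness_of_isRCLikeNormedField]
      exact WithTop.coe_le_coe.2 (le_top : (2 : ℕ∞) ≤ ⊤))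
  have hd : DifferentiableAt ℝ (fderiv ℝ F) p :=
    ((hF.fderiv_of_isOpen hU (m := (⊤ : ℕ∞)) (by simp)).contDiffAt (hU.mem_nhds hp)).differentiableAt
      (by simp)
  have key : ∀ a b : X, pd a (pd b F) p = fderiv ℝ (fderiv ℝ F) p a b := by
    intro a b
    unfold pd
    rw [fderiv_clm_apply hd (differentiableAt_const b)]
    simp
  rw [key, key]
  exact hs v w

lemma pd_congr {U : Set X} (hU : IsOpen U) {F G : X → ℝ} (h : EqOn F G U) {p : X} (hp : p ∈ U)
    (v : X) : pd v F p = pd v G p := by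
  unfold pd
  rw [(h.eventuallyEq_of_mem (hU.mem_nhds hp)).fderiv_eq]

lemma line_mem {U : Set X} (hU : IsOpen U) {p : X} (hp : p ∈ U) (v : X) :
    ∀ᶠ ε : ℝ in 𝓝 0, p + ε • v ∈ U := by
  have hc : ContinuousAt (fun ε : ℝ => p + ε • v) 0 := by fun_prop
  apply hc
  simpa using hU.mem_nhds hp

lemma second_test {U : Set X} (hU : IsOpen U) {F : X → ℝ} (hF : ContDiffOn ℝ (⊤ : ℕ∞) F U) {p v : X}
    (hp : p ∈ U) (hmax : IsLocalMax (fun ε : ℝ => F (p + ε • v)) 0) :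
    pd v F p = 0 ∧ pd v (pd v F) p ≤ 0 := by
  have h1 := hline v (sm_diff hU hF hp)
  have h2 := hline v (sm_diff hU (pd_smooth hU hF v) hp)
  have h0 : pd v F p = 0 := hmax.hasDerivAt_eq_zero h1
  refine ⟨h0, ?_⟩
  by_contra hc
  push Not at hc
  have hev : deriv (fun ε : ℝ => F (p + ε • v)) =ᶠ[𝓝 0] fun ε => pd v F (p + ε • v) := by
    filter_upwards [line_mem hU hp v] with ε hε
    exact (hline' (sm_diff hU hF hε)).deriv
  have hdd : deriv (deriv (fun ε : ℝ => F (p + ε • v))) 0 = pd v (pd v F) p := by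
    rw [hev.deriv_eq, h2.deriv]
  have hmin := isLocalMin_of_deriv_deriv_pos (f := fun ε : ℝ => F (p + ε • v)) (x₀ := 0)
    (by rw [hdd]; exact hc) (by rw [h1.deriv, h0]) h1.continuousAt
  have hconst : (fun ε : ℝ => F (p + ε • v)) =ᶠ[𝓝 0] fun _ => F (p + (0 : ℝ) • v) := by
    filter_upwards [hmin, hmax] with ε a b
    exact le_antisymm b a
  have : deriv (deriv (fun ε : ℝ => F (p + ε • v))) 0 = 0 := by
    have := hconst.deriv
    rw [this.deriv_eq]
    simp
  rw [hdd] at this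
  linarith

end toolkit

section bridge
variable {N : ℕ}

/-- spatial coordinate direction -/
def ee (i : Fin N) : EuclideanSpace ℝ (Fin N) × ℝ := (EuclideanSpace.single i 1, 0)

lemma inner_gradient {f : EuclideanSpace ℝ (Fin N) → ℝ} {x v : EuclideanSpace ℝ (Fin N)} :
    ⟪gradient f x, v⟫ = fderiv ℝ f x v := by
  unfold gradient
  exact InnerProductSpace.toDual_symm_apply

lemma fderiv_slice {G : EuclideanSpace ℝ (Fin N) × ℝ → ℝ} {x v : EuclideanSpace ℝ (Fin N)} {t : ℝ}
    (hG : DifferentiableAt ℝ G (x, t)) :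
    fderiv ℝ (fun y => G (y, t)) x v = pd (v, 0) G (x, t) := by
  have h1 : HasFDerivAt (fun y : EuclideanSpace ℝ (Fin N) => (y, t))
    (ContinuousLinearMap.inl ℝ (EuclideanSpace ℝ (Fin N)) ℝ) x := hasFDerivAt_prodMk_left x t
  have h2 := (hG.hasFDerivAt.comp x h1).fderiv
  have h3 : fderiv ℝ (fun y => G (y, t)) x =
    (fderiv ℝ G (x, t)).comp (ContinuousLinearMap.inl ℝ (EuclideanSpace ℝ (Fin N)) ℝ) := h2
  rw [h3]; simp [pd]

lemma grad_inner {G : EuclideanSpace ℝ (Fin N) × ℝ → ℝ} {x v : EuclideanSpace ℝ (Fin N)} {t : ℝ}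
    (hG : DifferentiableAt ℝ G (x, t)) :
    ⟪gradient (fun y => G (y, t)) x, v⟫ = pd (v, 0) G (x, t) := by
  rw [inner_gradient, fderiv_slice hG]

lemma grad_coord {G : EuclideanSpace ℝ (Fin N) × ℝ → ℝ} {x : EuclideanSpace ℝ (Fin N)} {t : ℝ}
    (hG : DifferentiableAt ℝ G (x, t)) (i : Fin N) :
    gradient (fun y => G (y, t)) x i = pd (ee i) G (x, t) := by
  have := grad_inner (v := EuclideanSpace.single i 1) hG
  rw [EuclideanSpace.inner_single_right] at this
  simpa [ee] using this

lemma hess_eq {G : EuclideanSpace ℝ (Fin N) × ℝ → ℝ} (hG : ContDiff ℝ (⊤ : ℕ∞) G)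
    (x v w : EuclideanSpace ℝ (Fin N)) (t : ℝ) :
    hess (fun y => G (y, t)) x v w = pd (v, 0) (pd (w, 0) G) (x, t) := by
  have hGd : Differentiable ℝ G := hG.differentiable (by simp)
  have hg : ContDiff ℝ (⊤ : ℕ∞) (fun y => G (y, t)) := by fun_prop
  have hgr : ContDiff ℝ (⊤ : ℕ∞) (gradient (fun y => G (y, t))) := by
    unfold gradient
    exact (InnerProductSpace.toDual ℝ (EuclideanSpace ℝ (Fin N))).symm.contDiff.comp
      (hg.fderiv_right (by simp))
  have hgd : DifferentiableAt ℝ (gradient (fun y => G (y, t))) x :=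
    (hgr.differentiable (by simp)) x
  unfold hess
  have h1 : (fun y => ⟪gradient (fun y => G (y, t)) y, w⟫) = fun y => pd (w, 0) G (y, t) := by
    funext y; exact grad_inner (hGd _)
  have h2 : fderiv ℝ (fun y => ⟪gradient (fun y => G (y, t)) y, w⟫) x v =
      ⟪fderiv ℝ (gradient (fun y => G (y, t))) x v, w⟫ := by
    rw [fderiv_inner_apply ℝ hgd (differentiableAt_const w)]
    simp
  rw [← h2, h1]
  apply fderiv_slice
  have := pd_smooth isOpen_univ (hG.contDiffOn) ((w, 0) : EuclideanSpace ℝ (Fin N) × ℝ)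
  exact sm_diff isOpen_univ this (mem_univ _)

lemma tderiv_eq {u : EuclideanSpace ℝ (Fin N) × ℝ → ℝ} {p : EuclideanSpace ℝ (Fin N) × ℝ}
    (hu : DifferentiableAt ℝ u p) : tderiv u p = pd (0, 1) u p := by
  unfold tderiv
  have h1 : HasDerivAt (fun s : ℝ => (p.1, s)) ((0, 1) : EuclideanSpace ℝ (Fin N) × ℝ) p.2 :=
    (hasDerivAt_const _ _).prodMk (hasDerivAt_id _)
  exact (hu.hasFDerivAt.comp_hasDerivAt p.2 h1).deriv

lemma ext_smooth {f : EuclideanSpace ℝ (Fin N) → ℝ} (hf : ContDiff ℝ (⊤ : ℕ∞) f) :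
    ContDiff ℝ (⊤ : ℕ∞) (fun p : EuclideanSpace ℝ (Fin N) × ℝ => f p.1) := by fun_prop

lemma inner_sum (a b : EuclideanSpace ℝ (Fin N)) : ⟪a, b⟫ = ∑ i, a i * b i := by
  simp [PiLp.inner_apply, mul_comm]

lemma swlap_eq {f : EuclideanSpace ℝ (Fin N) → ℝ} (hf : ContDiff ℝ (⊤ : ℕ∞) f)
    {u : EuclideanSpace ℝ (Fin N) × ℝ → ℝ} (hu : ContDiff ℝ (⊤ : ℕ∞) u)
    (p : EuclideanSpace ℝ (Fin N) × ℝ) :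
    swlap f u p = ∑ i, pd (ee i) (pd (ee i) u) p
      - ∑ i, pd (ee i) (fun p => f p.1) p * pd (ee i) u p := by
  unfold swlap wlap lap
  congr 1
  · refine Finset.sum_congr rfl fun i _ => ?_
    rw [hess_eq hu]; rfl
  · rw [inner_sum]
    refine Finset.sum_congr rfl fun i _ => ?_
    rw [grad_coord ((hu.differentiable (by simp)) _) i]
    have := grad_coord (G := fun p => f p.1) (x := p.1) (t := p.2)
      (((ext_smooth hf).differentiable (by simp)) _) i
    rw [← this]

lemma vec_sum (v : EuclideanSpace ℝ (Fin N)) :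
    ((v, 0) : EuclideanSpace ℝ (Fin N) × ℝ) = ∑ i, v i • ee i := by
  ext j
  · simp [ee, Prod.fst_sum, Pi.single_apply]
  · simp [ee, Prod.snd_sum]

lemma pd_sum_dir {F : EuclideanSpace ℝ (Fin N) × ℝ → ℝ} (v : EuclideanSpace ℝ (Fin N))
    (p : EuclideanSpace ℝ (Fin N) × ℝ) : pd (v, 0) F p = ∑ i, v i * pd (ee i) F p := by
  unfold pd
  rw [vec_sum, map_sum]
  simp

end bridge


section cut
variable {N : ℕ}

lemma grad_diff {f : EuclideanSpace ℝ (Fin N) → ℝ} (hf : ContDiff ℝ (⊤ : ℕ∞) f) :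
    ContDiff ℝ (⊤ : ℕ∞) (gradient f) := by
  unfold gradient
  exact (InnerProductSpace.toDual ℝ (EuclideanSpace ℝ (Fin N))).symm.contDiff.comp
      (hf.fderiv_right (by simp))

lemma radial {f : EuclideanSpace ℝ (Fin N) → ℝ} (hf : ContDiff ℝ (⊤ : ℕ∞) f) {κ : ℝ}
    (hκ : ∀ x v, -(κ * ‖v‖ ^ 2) ≤ hess f x v v) {x₀ x : EuclideanSpace ℝ (Fin N)} {M : ℝ}
    (hM : ∀ y ∈ sphere x₀ 1, ((N : ℝ) - 1) - ⟪gradient f y, y - x₀⟫ ≤ M)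
    (hr : 1 ≤ ‖x - x₀‖) :
    ‖x - x₀‖ * (((N : ℝ) - 1) - M) - ‖x - x₀‖ * (κ * (‖x - x₀‖ - 1)) ≤ ⟪gradient f x, x - x₀⟫ := by
  set r := ‖x - x₀‖ with hrdef
  have hr0 : 0 < r := by linarith
  set e : EuclideanSpace ℝ (Fin N) := r⁻¹ • (x - x₀) with he
  have hxe : x - x₀ = r • e := by rw [he, smul_smul, mul_inv_cancel₀ hr0.ne', one_smul]
  have hen : ‖e‖ = 1 := by
    rw [he, norm_smul, norm_inv, Real.norm_of_nonneg hr0.le, ← hrdef, inv_mul_cancel₀ hr0.ne']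
  have hgd := (grad_diff hf).differentiable (by simp)
  have hder : ∀ ρ : ℝ, HasDerivAt (fun ρ : ℝ => ⟪gradient f (x₀ + ρ • e), e⟫ + κ * ρ)
      (hess f (x₀ + ρ • e) e e + κ) ρ := by
    intro ρ
    have h1 : HasDerivAt (fun ε : ℝ => x₀ + ε • e) e ρ := by
      simpa using ((hasDerivAt_id ρ).smul_const e).const_add x₀
    have h2 := (hgd (x₀ + ρ • e)).hasFDerivAt.comp_hasDerivAt ρ h1
    have h3 := h2.inner ℝ (hasDerivAt_const ρ e)
    have h4 := (hasDerivAt_id ρ).const_mul κ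
    have h5 := h3.add h4
    simp only [inner_zero_right, zero_add, mul_one] at h5
    exact h5
  have hmono : Monotone (fun ρ : ℝ => ⟪gradient f (x₀ + ρ • e), e⟫ + κ * ρ) := by
    apply monotone_of_hasDerivAt_nonneg hder
    intro ρ
    have := hκ (x₀ + ρ • e) e
    rw [hen] at this
    simp only [Pi.zero_apply]
    linarith
  have hm := hmono hr
  simp only [one_smul] at hm
  have hx : x₀ + r • e = x := by rw [← hxe]; abel
  rw [hx] at hm
  have h1 := hM (x₀ + e) (by simp [hen])
  simp only [add_sub_cancel_left] at h1
  rw [hxe, inner_smul_right]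
  have : ((N : ℝ) - 1 - M) - κ * (r - 1) ≤ ⟪gradient f x, e⟫ := by linarith
  have := mul_le_mul_of_nonneg_left this hr0.le
  linarith

/-- space cutoff -/
def cut (θ : ℝ → ℝ) (x₀ : EuclideanSpace ℝ (Fin N)) (R : ℝ) (p : EuclideanSpace ℝ (Fin N) × ℝ) : ℝ :=
  θ (‖p.1 - x₀‖ ^ 2 / R ^ 2)

lemma cut_smooth {θ : ℝ → ℝ} (hθ : ContDiff ℝ (⊤ : ℕ∞) θ) (x₀ : EuclideanSpace ℝ (Fin N)) (R : ℝ) :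
    ContDiff ℝ (⊤ : ℕ∞) (cut θ x₀ R) := by
  unfold cut
  refine hθ.comp ?_
  have : ContDiff ℝ (⊤ : ℕ∞) (fun p : EuclideanSpace ℝ (Fin N) × ℝ => ‖p.1 - x₀‖ ^ 2) := by
    apply ContDiff.norm_sq ℝ; fun_prop
  exact this.div_const _

lemma cut_line {θ : ℝ → ℝ} (hθ : Differentiable ℝ θ) (x₀ : EuclideanSpace ℝ (Fin N)) (R : ℝ)
    (p : EuclideanSpace ℝ (Fin N) × ℝ) (i : Fin N) :
    HasDerivAt (fun ε : ℝ => θ (‖(p + ε • ee i).1 - x₀‖ ^ 2 / R ^ 2))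
      (deriv θ (‖p.1 - x₀‖ ^ 2 / R ^ 2) * (2 * (p.1 - x₀) i / R ^ 2)) 0 := by
  have h1 : HasDerivAt (fun ε : ℝ => (p + ε • ee i).1 - x₀) (EuclideanSpace.single i (1 : ℝ)) 0 := by
    have : HasDerivAt (fun ε : ℝ => (p.1 - x₀) + ε • EuclideanSpace.single i (1 : ℝ))
      (EuclideanSpace.single i (1 : ℝ)) 0 := by
      simpa using ((hasDerivAt_id (0 : ℝ)).smul_const (EuclideanSpace.single i (1 : ℝ))).const_add
        (p.1 - x₀)
    refine this.congr_of_eventuallyEq (Eventually.of_forall fun ε => ?_)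
    simp [ee]; abel
  have h2 := (h1.norm_sq).div_const (R ^ 2)
  have h3 := HasDerivAt.comp (0 : ℝ) (h₂ := θ)
    (h := fun ε : ℝ => ‖(p + ε • ee i).1 - x₀‖ ^ 2 / R ^ 2) (hθ _).hasDerivAt h2
  refine h3.congr_deriv ?_
  simp [EuclideanSpace.inner_single_right]

lemma cut_pd {θ : ℝ → ℝ} (hθ : ContDiff ℝ (⊤ : ℕ∞) θ) (x₀ : EuclideanSpace ℝ (Fin N)) (R : ℝ)
    (i : Fin N) :
    pd (ee i) (cut θ x₀ R) =
      fun p => deriv θ (‖p.1 - x₀‖ ^ 2 / R ^ 2) * (2 * (p.1 - x₀) i / R ^ 2) := by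
  funext p
  exact pd_eq (((cut_smooth hθ x₀ R).differentiable (by simp)) p)
    (cut_line (hθ.differentiable (by simp)) x₀ R p i)

lemma cut_pd2 {θ : ℝ → ℝ} (hθ : ContDiff ℝ (⊤ : ℕ∞) θ) (x₀ : EuclideanSpace ℝ (Fin N)) (R : ℝ)
    (i : Fin N) (p : EuclideanSpace ℝ (Fin N) × ℝ) :
    pd (ee i) (pd (ee i) (cut θ x₀ R)) p =
      deriv (deriv θ) (‖p.1 - x₀‖ ^ 2 / R ^ 2) * (2 * (p.1 - x₀) i / R ^ 2) ^ 2
      + deriv θ (‖p.1 - x₀‖ ^ 2 / R ^ 2) * (2 / R ^ 2) := by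
  have hs : DifferentiableAt ℝ (pd (ee i) (cut θ x₀ R)) p :=
    sm_diff isOpen_univ (pd_smooth isOpen_univ (cut_smooth hθ x₀ R).contDiffOn _) (mem_univ _)
  refine pd_eq hs ?_
  rw [cut_pd hθ]
  have hθ' : Differentiable ℝ (deriv θ) :=
    ((contDiff_infty_iff_deriv.1 hθ).2).differentiable (by simp)
  have h1 := cut_line hθ' x₀ R p i
  have h2 : HasDerivAt (fun ε : ℝ => 2 * ((p + ε • ee i).1 - x₀) i / R ^ 2) (2 / R ^ 2) 0 := by
    have : HasDerivAt (fun ε : ℝ => 2 * ((p.1 - x₀) i + ε) / R ^ 2) (2 / R ^ 2) 0 := by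
      simpa using (((hasDerivAt_id (0 : ℝ)).const_add ((p.1 - x₀) i)).const_mul 2).div_const (R ^ 2)
    refine this.congr_of_eventuallyEq (Eventually.of_forall fun ε => ?_)
    simp [ee]; ring
  have h3 := h1.mul h2
  simp only [zero_smul, add_zero] at h3
  refine h3.congr_deriv ?_
  ring

lemma norm_sum (a : EuclideanSpace ℝ (Fin N)) : ‖a‖ ^ 2 = ∑ i, a i ^ 2 := by
  rw [EuclideanSpace.norm_sq_eq]; simp

lemma cut_grad {θ : ℝ → ℝ} (hθ : ContDiff ℝ (⊤ : ℕ∞) θ) {c : ℝ} (hc : 1 ≤ c)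
    (hθ2 : ∀ x ∈ Icc (0 : ℝ) 1, deriv θ x ^ 2 ≤ c * θ x) (hθ0 : ∀ x, 0 ≤ θ x)
    (x₀ : EuclideanSpace ℝ (Fin N)) {R : ℝ}
    (hR : 2 ≤ R) (p : EuclideanSpace ℝ (Fin N) × ℝ) (hp : ‖p.1 - x₀‖ ≤ R) :
    ∑ i, pd (ee i) (cut θ x₀ R) p ^ 2 ≤ (2 * c / R) ^ 2 * cut θ x₀ R p := by
  simp only [cut_pd hθ]
  set σ := ‖p.1 - x₀‖ ^ 2 / R ^ 2 with hσ
  have hR0 : 0 < R := by linarith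
  have hσ1 : σ ≤ 1 := by
    rw [hσ, div_le_one (by positivity)]
    gcongr
  have h0 : 0 ≤ σ := by positivity
  have e : ∑ i, (deriv θ σ * (2 * (p.1 - x₀) i / R ^ 2)) ^ 2 = deriv θ σ ^ 2 * (4 * σ / R ^ 2) := by
    rw [hσ, norm_sum (p.1 - x₀), Finset.sum_div, Finset.mul_sum, Finset.sum_div, Finset.mul_sum]
    refine Finset.sum_congr rfl fun i _ => ?_
    field_simp
    ring
  rw [e]
  have h1 := hθ2 σ ⟨h0, hσ1⟩
  have hθσ := hθ0 σ
  have ec : cut θ x₀ R p = θ σ := rfl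
  rw [ec]
  calc deriv θ σ ^ 2 * (4 * σ / R ^ 2) ≤ (c * θ σ) * (4 * 1 / R ^ 2) := by gcongr
    _ = (c * 1) * (4 / R ^ 2 * θ σ) := by ring
    _ ≤ (c * c) * (4 / R ^ 2 * θ σ) := by gcongr
    _ = _ := by ring

set_option maxHeartbeats 1000000 in
lemma cut_lap {f : EuclideanSpace ℝ (Fin N) → ℝ} (hf : ContDiff ℝ (⊤ : ℕ∞) f) {κ : ℝ} (hκ0 : 0 ≤ κ)
    (hκ : ∀ x v, -(κ * ‖v‖ ^ 2) ≤ hess f x v v) {x₀ : EuclideanSpace ℝ (Fin N)} {M : ℝ}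
    (hM : ∀ y ∈ sphere x₀ 1, ((N : ℝ) - 1) - ⟪gradient f y, y - x₀⟫ ≤ M) (hN : 1 ≤ N)
    {θ : ℝ → ℝ} (hθ : ContDiff ℝ (⊤ : ℕ∞) θ) {c : ℝ} (hc : 1 ≤ c)
    (hθ1 : ∀ x ≤ 1 / 4, θ x = 1) (hθd : ∀ x, deriv θ x ≤ 0)
    (hθ3 : ∀ x ∈ Icc (0 : ℝ) 1, |deriv θ x| ≤ c) (hθ4 : ∀ x ∈ Icc (0 : ℝ) 1, |deriv (deriv θ) x| ≤ c)
    {R : ℝ} (hR : 2 ≤ R) (p : EuclideanSpace ℝ (Fin N) × ℝ) (hp : ‖p.1 - x₀‖ ≤ R) :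
    -(c * (4 * N * ((1 + |M|) / R) + 2 * κ)) ≤ ∑ i, pd (ee i) (pd (ee i) (cut θ x₀ R)) p
      - ∑ i, pd (ee i) (fun p => f p.1) p * pd (ee i) (cut θ x₀ R) p := by
  have hN1 : (1 : ℝ) ≤ N := by exact_mod_cast hN
  simp only [cut_pd2 hθ]
  rw [show (∑ i, pd (ee i) (fun p => f p.1) p * pd (ee i) (cut θ x₀ R) p) =
    ∑ i, pd (ee i) (fun p => f p.1) p *
      (deriv θ (‖p.1 - x₀‖ ^ 2 / R ^ 2) * (2 * (p.1 - x₀) i / R ^ 2)) from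
      Finset.sum_congr rfl fun i _ => by rw [cut_pd hθ]]
  set r := ‖p.1 - x₀‖ with hr
  set σ := r ^ 2 / R ^ 2 with hσ
  have hR0 : 0 < R := by linarith
  have hr0 : 0 ≤ r := norm_nonneg _
  have hσ1 : σ ≤ 1 := by
    rw [hσ, div_le_one (by positivity)]
    gcongr
  have h0 : 0 ≤ σ := by positivity
  have hin : ⟪gradient f p.1, p.1 - x₀⟫ = ∑ i, pd (ee i) (fun p => f p.1) p * (p.1 - x₀) i := by
    rw [inner_sum]
    refine Finset.sum_congr rfl fun i _ => ?_
    have := grad_coord (G := fun p => f p.1) (x := p.1) (t := p.2)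
      (((ext_smooth hf).differentiable (by simp)) _) i
    rw [← this]
  have e1 : ∑ i, (deriv (deriv θ) σ * (2 * (p.1 - x₀) i / R ^ 2) ^ 2 + deriv θ σ * (2 / R ^ 2))
      = deriv (deriv θ) σ * (4 * σ / R ^ 2) + deriv θ σ * (2 * N / R ^ 2) := by
    rw [Finset.sum_add_distrib]
    congr 1
    · rw [hσ, hr, norm_sum (p.1 - x₀), Finset.sum_div, Finset.mul_sum, Finset.sum_div,
        Finset.mul_sum]
      refine Finset.sum_congr rfl fun i _ => ?_
      field_simp
      ring
    · simp; ring
  have e2 : ∑ i, pd (ee i) (fun p => f p.1) p * (deriv θ σ * (2 * (p.1 - x₀) i / R ^ 2))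
      = deriv θ σ * (2 * ⟪gradient f p.1, p.1 - x₀⟫ / R ^ 2) := by
    rw [hin, Finset.mul_sum, Finset.sum_div, Finset.mul_sum]
    exact Finset.sum_congr rfl fun i _ => by ring
  rw [e1, e2]
  have hd := hθd σ
  have hd3 := hθ3 σ ⟨h0, hσ1⟩
  have hd4 := neg_le_of_abs_le (hθ4 σ ⟨h0, hσ1⟩)
  have hd3' := neg_le_of_abs_le hd3
  have hMM := le_abs_self M
  have hMa := abs_nonneg M
  have hRR : 2 / R ^ 2 ≤ (1 + |M|) / R := by
    rw [div_le_div_iff₀ (by positivity) hR0]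
    nlinarith [mul_nonneg hMa hR0.le]
  have hfrac : 0 ≤ (1 + |M|) / R := by positivity
  have g1 : -(c * (2 * ((1 + |M|) / R))) ≤ deriv (deriv θ) σ * (4 * σ / R ^ 2) := by
    have a1 : 4 * σ / R ^ 2 ≤ 2 * ((1 + |M|) / R) := by
      calc 4 * σ / R ^ 2 ≤ 4 * 1 / R ^ 2 := by gcongr
        _ = 2 * (2 / R ^ 2) := by ring
        _ ≤ _ := by gcongr
    have a0 : 0 ≤ 4 * σ / R ^ 2 := by positivity
    nlinarith
  have g2 : -(c * (2 * N * ((1 + |M|) / R) + 2 * κ)) ≤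
      deriv θ σ * (2 * N / R ^ 2) - deriv θ σ * (2 * ⟪gradient f p.1, p.1 - x₀⟫ / R ^ 2) := by
    have hBn : 0 ≤ 2 * N * ((1 + |M|) / R) + 2 * κ := by positivity
    rcases lt_or_ge σ (1 / 4) with hlt | hge
    · have : deriv θ σ = 0 := by
        have : θ =ᶠ[𝓝 σ] fun _ => 1 := by
          filter_upwards [Iio_mem_nhds hlt] with y hy
          exact hθ1 y (le_of_lt hy)
        rw [this.deriv_eq]; simp
      rw [this]
      have := mul_nonneg (show 0 ≤ c by linarith) hBn
      linarith
    · have hr1 : 1 ≤ r := by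
        rw [hσ, le_div_iff₀ (by positivity)] at hge
        by_contra hcon
        push Not at hcon
        nlinarith
      have hrad := radial hf hκ hM (x := p.1) hr1
      rw [← hr] at hrad
      have hup : 2 * N / R ^ 2 - 2 * ⟪gradient f p.1, p.1 - x₀⟫ / R ^ 2
          ≤ 2 * N * ((1 + |M|) / R) + 2 * κ := by
        have b1 : -⟪gradient f p.1, p.1 - x₀⟫ ≤ R * |M| + κ * R ^ 2 := by
          have i1 : r * M ≤ R * |M| := by
            calc r * M ≤ r * |M| := by gcongr
              _ ≤ _ := by gcongr
          have i2 : r * (κ * (r - 1)) ≤ κ * R ^ 2 := by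
            have : r * (r - 1) ≤ R ^ 2 := by nlinarith
            nlinarith
          have i3 : 0 ≤ r * ((N : ℝ) - 1) := by
            have : 0 ≤ (N : ℝ) - 1 := by linarith
            positivity
          linarith
        have b2 : 2 * N / R ^ 2 - 2 * ⟪gradient f p.1, p.1 - x₀⟫ / R ^ 2 ≤
            (2 * N + 2 * (R * |M| + κ * R ^ 2)) / R ^ 2 := by
          rw [← sub_div]; gcongr; linarith
        refine b2.trans ?_
        rw [div_le_iff₀ (by positivity)]
        have : (2 * N * ((1 + |M|) / R) + 2 * κ) * R ^ 2 = 2 * N * (1 + |M|) * R + 2 * κ * R ^ 2 := by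
          field_simp
        rw [this]
        have j1 : 2 * (N : ℝ) ≤ 2 * N * R := by nlinarith
        have j2 : 2 * (R * |M|) ≤ 2 * N * |M| * R := by
          have := mul_nonneg hMa hR0.le
          nlinarith
        linarith
      have h5 : deriv θ σ * (2 * N / R ^ 2) - deriv θ σ * (2 * ⟪gradient f p.1, p.1 - x₀⟫ / R ^ 2)
        = deriv θ σ * (2 * N / R ^ 2 - 2 * ⟪gradient f p.1, p.1 - x₀⟫ / R ^ 2) := by ring
      rw [h5]
      have h6 := mul_le_mul_of_nonpos_left hup hd
      have h7 := mul_le_mul_of_nonneg_right hd3' hBn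
      linarith
  have : c * (2 * ((1 + |M|) / R)) ≤ c * (2 * N * ((1 + |M|) / R)) := by
    gcongr; nlinarith
  linarith

end cut


section calc1
variable {X : Type*} [NormedAddCommGroup X] [NormedSpace ℝ X] {U : Set X}

lemma pd_mul (hU : IsOpen U) {F G : X → ℝ} (hF : ContDiffOn ℝ (⊤ : ℕ∞) F U)
    (hG : ContDiffOn ℝ (⊤ : ℕ∞) G U) {p : X} (hp : p ∈ U) (v : X) :
    pd v (fun p => F p * G p) p = pd v F p * G p + F p * pd v G p := by
  have h := (hline v (sm_diff hU hF hp)).mul (hline v (sm_diff hU hG hp))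
  simp only [zero_smul, add_zero] at h
  exact pd_eq (sm_diff hU (hF.mul hG) hp) h

lemma pd_mul2 (hU : IsOpen U) {F G : X → ℝ} (hF : ContDiffOn ℝ (⊤ : ℕ∞) F U)
    (hG : ContDiffOn ℝ (⊤ : ℕ∞) G U) {p : X} (hp : p ∈ U) (v : X) :
    pd v (pd v (fun p => F p * G p)) p =
      pd v (pd v F) p * G p + 2 * (pd v F p * pd v G p) + F p * pd v (pd v G) p := by
  have hF' := pd_smooth hU hF v
  have hG' := pd_smooth hU hG v
  have e : EqOn (pd v (fun p => F p * G p)) (fun p => pd v F p * G p + F p * pd v G p) U :=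
    fun y hy => pd_mul hU hF hG hy v
  rw [pd_congr hU e hp]
  have h := ((hline v (sm_diff hU hF' hp)).mul (hline v (sm_diff hU hG hp))).add
    ((hline v (sm_diff hU hF hp)).mul (hline v (sm_diff hU hG' hp)))
  simp only [zero_smul, add_zero] at h
  have h' := h.congr_deriv (g' := pd v (pd v F) p * G p + 2 * (pd v F p * pd v G p)
    + F p * pd v (pd v G) p) (by ring)
  exact pd_eq (sm_diff hU ((hF'.mul hG).add (hF.mul hG')) hp) h'

lemma pd_log (hU : IsOpen U) {g : X → ℝ} (hg : ContDiffOn ℝ (⊤ : ℕ∞) g U) (hpos : ∀ y ∈ U, 0 < g y)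
    {p : X} (hp : p ∈ U) (v : X) :
    pd v (fun p => Real.log (g p)) p = pd v g p / g p := by
  have h := (hline v (sm_diff hU hg hp)).log (by simpa using (hpos p hp).ne')
  simp only [zero_smul, add_zero] at h
  exact pd_eq (sm_diff hU (hg.log fun y hy => (hpos y hy).ne') hp) h

lemma pd_log2 (hU : IsOpen U) {g : X → ℝ} (hg : ContDiffOn ℝ (⊤ : ℕ∞) g U) (hpos : ∀ y ∈ U, 0 < g y)
    {p : X} (hp : p ∈ U) (v : X) :
    pd v (pd v (fun p => Real.log (g p))) p = pd v (pd v g) p / g p - (pd v g p / g p) ^ 2 := by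
  have hg' := pd_smooth hU hg v
  have e : EqOn (pd v (fun p => Real.log (g p))) (fun p => pd v g p / g p) U :=
    fun y hy => pd_log hU hg hpos hy v
  rw [pd_congr hU e hp]
  have hne := (hpos p hp).ne'
  have h := (hline v (sm_diff hU hg' hp)).div (hline v (sm_diff hU hg hp)) (by simpa using hne)
  simp only [zero_smul, add_zero] at h
  have h' := h.congr_deriv (g' := pd v (pd v g) p / g p - (pd v g p / g p) ^ 2) (by field_simp)
  exact pd_eq (sm_diff hU (hg'.div hg fun y hy => (hpos y hy).ne') hp) h'

lemma pd_const_sub (c : ℝ) (F : X → ℝ) (v : X) : pd v (fun p => c - F p) = fun p => - pd v F p := by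
  funext p; unfold pd; rw [fderiv_const_sub]; rfl

lemma pd_neg (F : X → ℝ) (v : X) : pd v (fun p => - F p) = fun p => - pd v F p := by
  funext p; unfold pd; rw [fderiv_fun_neg]; rfl

lemma pd_sumsq (hU : IsOpen U) {ι : Type*} [Fintype ι] {a : ι → X → ℝ}
    (ha : ∀ i, ContDiffOn ℝ (⊤ : ℕ∞) (a i) U) {p : X} (hp : p ∈ U) (v : X) :
    pd v (fun p => ∑ i, a i p ^ 2) p = 2 * ∑ i, a i p * pd v (a i) p := by
  have h := HasDerivAt.fun_sum (u := Finset.univ)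
    (fun i _ => (hline v (sm_diff hU (ha i) hp)).fun_pow 2)
  have h' := h.congr_deriv (g' := 2 * ∑ i, a i p * pd v (a i) p) (by
    rw [Finset.mul_sum]; refine Finset.sum_congr rfl fun i _ => ?_
    simp; ring)
  exact pd_eq (sm_diff hU (ContDiffOn.sum fun i _ => (ha i).pow 2) hp) h'

lemma pd_sumsq2 (hU : IsOpen U) {ι : Type*} [Fintype ι] {a : ι → X → ℝ}
    (ha : ∀ i, ContDiffOn ℝ (⊤ : ℕ∞) (a i) U) {p : X} (hp : p ∈ U) (v : X) :
    pd v (pd v (fun p => ∑ i, a i p ^ 2)) p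
      = 2 * ∑ i, (pd v (a i) p ^ 2 + a i p * pd v (pd v (a i)) p) := by
  have ha' := fun i => pd_smooth hU (ha i) v
  have e : EqOn (pd v (fun p => ∑ i, a i p ^ 2)) (fun p => 2 * ∑ i, a i p * pd v (a i) p) U :=
    fun y hy => pd_sumsq hU ha hy v
  rw [pd_congr hU e hp]
  have h := (HasDerivAt.fun_sum (u := Finset.univ)
    (fun i _ => (hline v (sm_diff hU (ha i) hp)).fun_mul (hline v (sm_diff hU (ha' i) hp)))).const_mul 2
  have h' := h.congr_deriv (g' := 2 * ∑ i, (pd v (a i) p ^ 2 + a i p * pd v (pd v (a i)) p)) (by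
    congr 1; refine Finset.sum_congr rfl fun i _ => ?_
    simp; ring)
  exact pd_eq (sm_diff hU (contDiffOn_const.mul
    (ContDiffOn.sum fun i _ => (ha i).mul (ha' i))) hp) h'

end calc1

section pde
variable {N : ℕ} {U : Set (EuclideanSpace ℝ (Fin N) × ℝ)}

/-- `1 + log (D / u)` -/
def gg (D : ℝ) (u : EuclideanSpace ℝ (Fin N) × ℝ → ℝ) (p : EuclideanSpace ℝ (Fin N) × ℝ) : ℝ :=
  (1 + Real.log D) - Real.log (u p)

/-- `log (1 + log (D / u))` -/
def ph (D : ℝ) (u : EuclideanSpace ℝ (Fin N) × ℝ → ℝ) (p : EuclideanSpace ℝ (Fin N) × ℝ) : ℝ :=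
  Real.log (gg D u p)

lemma gg_smooth {D : ℝ} {u : EuclideanSpace ℝ (Fin N) × ℝ → ℝ} (hu : ContDiff ℝ (⊤ : ℕ∞) u)
    (hpos : ∀ p ∈ U, 0 < u p) : ContDiffOn ℝ (⊤ : ℕ∞) (gg D u) U :=
  contDiffOn_const.sub (hu.contDiffOn.log fun y hy => (hpos y hy).ne')

lemma ph_smooth {D : ℝ} {u : EuclideanSpace ℝ (Fin N) × ℝ → ℝ} (hu : ContDiff ℝ (⊤ : ℕ∞) u)
    (hpos : ∀ p ∈ U, 0 < u p) (hg : ∀ p ∈ U, 0 < gg D u p) : ContDiffOn ℝ (⊤ : ℕ∞) (ph D u) U :=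
  (gg_smooth hu hpos).log fun y hy => (hg y hy).ne'

lemma gg_pd {D : ℝ} {u : EuclideanSpace ℝ (Fin N) × ℝ → ℝ} (hU : IsOpen U)
    (hu : ContDiff ℝ (⊤ : ℕ∞) u)
    (hpos : ∀ p ∈ U, 0 < u p) {p} (hp : p ∈ U) (v) :
    pd v (gg D u) p = - (pd v u p / u p) := by
  unfold gg
  rw [pd_const_sub]
  beta_reduce
  rw [pd_log hU hu.contDiffOn hpos hp]

lemma gg_pd2 {D : ℝ} {u : EuclideanSpace ℝ (Fin N) × ℝ → ℝ} (hU : IsOpen U)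
    (hu : ContDiff ℝ (⊤ : ℕ∞) u)
    (hpos : ∀ p ∈ U, 0 < u p) {p} (hp : p ∈ U) (v) :
    pd v (pd v (gg D u)) p = - (pd v (pd v u) p / u p) + (pd v u p / u p) ^ 2 := by
  unfold gg
  rw [pd_const_sub, pd_neg]
  beta_reduce
  rw [pd_log2 hU hu.contDiffOn hpos hp]
  ring

lemma ph_pd {D : ℝ} {u : EuclideanSpace ℝ (Fin N) × ℝ → ℝ} (hU : IsOpen U)
    (hu : ContDiff ℝ (⊤ : ℕ∞) u)
    (hpos : ∀ p ∈ U, 0 < u p) (hg : ∀ p ∈ U, 0 < gg D u p) {p} (hp : p ∈ U) (v) :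
    pd v (ph D u) p = pd v (gg D u) p / gg D u p := by
  unfold ph
  rw [pd_log hU (gg_smooth hu hpos) hg hp]

/-- the reaction term for `ph`. -/
def HH (D α : ℝ) (q u : EuclideanSpace ℝ (Fin N) × ℝ → ℝ) (p : EuclideanSpace ℝ (Fin N) × ℝ) : ℝ :=
  q p * Real.exp ((α - 1) * (1 + Real.log D - gg D u p)) / gg D u p

lemma ph_pde {D α : ℝ} {u q : EuclideanSpace ℝ (Fin N) × ℝ → ℝ} (hU : IsOpen U)
    (hu : ContDiff ℝ (⊤ : ℕ∞) u) {f : EuclideanSpace ℝ (Fin N) → ℝ} (hf : ContDiff ℝ (⊤ : ℕ∞) f)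
    (hpos : ∀ p ∈ U, 0 < u p) (hg : ∀ p ∈ U, 0 < gg D u p) {p} (hp : p ∈ U)
    (hpde : tderiv u p = swlap f u p + q p * u p ^ α) :
    pd (0, 1) (ph D u) p = ∑ i, (pd (ee i) (pd (ee i) (ph D u)) p + pd (ee i) (ph D u) p ^ 2
        - gg D u p * pd (ee i) (ph D u) p ^ 2)
      - ∑ i, pd (ee i) (fun p => f p.1) p * pd (ee i) (ph D u) p - HH D α q u p := by
  rw [tderiv_eq ((hu.differentiable (by simp)) p), swlap_eq hf hu] at hpde
  have hup := hpos p hp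
  have hgp := hg p hp
  have e2 : ∀ v, pd v (pd v (ph D u)) p =
      pd v (pd v (gg D u)) p / gg D u p - (pd v (gg D u) p / gg D u p) ^ 2 := by
    intro v
    unfold ph
    rw [pd_log2 hU (gg_smooth hu hpos) hg hp]
  have hE : Real.exp ((α - 1) * (1 + Real.log D - gg D u p)) * u p = u p ^ α := by
    have : 1 + Real.log D - gg D u p = Real.log (u p) := by unfold gg; ring
    rw [this, mul_comm (α - 1), ← Real.rpow_def_of_pos hup, Real.rpow_sub_one hup.ne']
    field_simp
  simp only [e2, ph_pd hU hu hpos hg hp, gg_pd2 hU hu hpos hp, gg_pd hU hu hpos hp]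
  unfold HH
  have hsum1 : ∀ i : Fin N, ((-(pd (ee i) (pd (ee i) u) p / u p) + (pd (ee i) u p / u p) ^ 2) / gg D u p -
            (-(pd (ee i) u p / u p) / gg D u p) ^ 2 +
          (-(pd (ee i) u p / u p) / gg D u p) ^ 2 -
        gg D u p * (-(pd (ee i) u p / u p) / gg D u p) ^ 2)
      = - (pd (ee i) (pd (ee i) u) p) * (1 / (u p * gg D u p)) := by
    intro i; field_simp; ring
  have hsum2 : ∀ i : Fin N, pd (ee i) (fun p => f p.1) p * (-(pd (ee i) u p / u p) / gg D u p)
    = -(pd (ee i) (fun p => f p.1) p * pd (ee i) u p) * (1 / (u p * gg D u p)) := by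
    intro i; field_simp
  simp only [hsum1, hsum2, ← Finset.sum_mul, Finset.sum_neg_distrib]
  rw [hpde, ← hE]
  field_simp
  ring

lemma HH_pd {D α : ℝ} {u q : EuclideanSpace ℝ (Fin N) × ℝ → ℝ} (hU : IsOpen U)
    (hu : ContDiff ℝ (⊤ : ℕ∞) u) (hq : ContDiff ℝ (⊤ : ℕ∞) q)
    (hpos : ∀ p ∈ U, 0 < u p) (hg : ∀ p ∈ U, 0 < gg D u p) {p} (hp : p ∈ U) (v) :
    HasDerivAt (fun ε : ℝ => HH D α q u (p + ε • v))
      (Real.exp ((α - 1) * (1 + Real.log D - gg D u p)) *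
        (pd v q p / gg D u p - q p * (α - 1) * pd v (ph D u) p - q p * pd v (ph D u) p / gg D u p)) 0 := by
  have hgp := hg p hp
  have h1 := hline v ((hq.differentiable (by simp)) p)
  have h2 := hline v (sm_diff hU (gg_smooth (D := D) hu hpos) hp)
  have h3 := ((h1.mul (((h2.const_sub (1 + Real.log D)).const_mul (α - 1)).exp)).div h2
    (by simpa using hgp.ne'))
  refine h3.congr_deriv ?_
  simp only [zero_smul, add_zero, Pi.mul_apply]
  rw [ph_pd hU hu hpos hg hp]
  field_simp
  ring

lemma ph_pde_pd {D α : ℝ} {u q : EuclideanSpace ℝ (Fin N) × ℝ → ℝ} (hU : IsOpen U)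
    (hu : ContDiff ℝ (⊤ : ℕ∞) u) (hq : ContDiff ℝ (⊤ : ℕ∞) q)
    {f : EuclideanSpace ℝ (Fin N) → ℝ} (hf : ContDiff ℝ (⊤ : ℕ∞) f)
    (hpos : ∀ p ∈ U, 0 < u p) (hg : ∀ p ∈ U, 0 < gg D u p) {p} (hp : p ∈ U) (j : Fin N)
    (hpde : ∀ᶠ ε : ℝ in 𝓝 0, tderiv u (p + ε • ee j) = swlap f u (p + ε • ee j)
      + q (p + ε • ee j) * u (p + ε • ee j) ^ α) :
    pd (ee j) (pd (0, 1) (ph D u)) p =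
      ∑ i, (pd (ee j) (pd (ee i) (pd (ee i) (ph D u))) p
          + 2 * pd (ee i) (ph D u) p * pd (ee j) (pd (ee i) (ph D u)) p
          - gg D u p * pd (ee j) (ph D u) p * pd (ee i) (ph D u) p ^ 2
          - 2 * gg D u p * pd (ee i) (ph D u) p * pd (ee j) (pd (ee i) (ph D u)) p)
      - ∑ i, pd (ee j) (pd (ee i) (fun p => f p.1)) p * pd (ee i) (ph D u) p
      - ∑ i, pd (ee i) (fun p => f p.1) p * pd (ee j) (pd (ee i) (ph D u)) p
      - Real.exp ((α - 1) * (1 + Real.log D - gg D u p)) *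
        (pd (ee j) q p / gg D u p - q p * (α - 1) * pd (ee j) (ph D u) p
          - q p * pd (ee j) (ph D u) p / gg D u p) := by
  have hgp := hg p hp
  have hφ := ph_smooth (D := D) hu hpos hg
  have hF := (ext_smooth hf).contDiffOn (s := U)
  have hL := hline (ee j) (sm_diff hU (pd_smooth hU hφ (0, 1)) hp)
  have hii := fun i : Fin N =>
    hline (ee j) (sm_diff hU (pd_smooth hU (pd_smooth hU hφ (ee i)) (ee i)) hp)
  have hi := fun i : Fin N => hline (ee j) (sm_diff hU (pd_smooth hU hφ (ee i)) hp)
  have hfi := fun i : Fin N => hline (ee j) (sm_diff hU (pd_smooth hU hF (ee i)) hp)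
  have hgl := hline (ee j) (sm_diff hU (gg_smooth (D := D) hu hpos) hp)
  have hH := HH_pd (D := D) (α := α) hU hu hq hpos hg hp (ee j)
  have hR := ((HasDerivAt.fun_sum (u := Finset.univ) fun i _ =>
    ((hii i).fun_add ((hi i).fun_pow 2)).fun_sub (hgl.fun_mul ((hi i).fun_pow 2))).fun_sub
    (HasDerivAt.fun_sum (u := Finset.univ) fun i _ => (hfi i).fun_mul (hi i))).fun_sub hH
  have hfin := hR.congr_of_eventuallyEq (f₁ := fun ε : ℝ => pd (0, 1) (ph D u) (p + ε • ee j)) (by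
    filter_upwards [hpde, line_mem hU hp (ee j)] with ε h1 h2
    exact ph_pde hU hu hf hpos hg h2 h1)
  rw [hL.unique hfin]
  have hgj : pd (ee j) (gg D u) p = gg D u p * pd (ee j) (ph D u) p := by
    rw [ph_pd hU hu hpos hg hp]; field_simp
  rw [hgj]
  simp only [zero_smul, add_zero]
  rw [Finset.sum_add_distrib, sub_sub (∑ i, _) (∑ i, _) (∑ i, _)]
  congr 2
  refine Finset.sum_congr rfl fun i _ => ?_
  simp
  ring

end pde


section point
variable {N : ℕ} {U : Set (EuclideanSpace ℝ (Fin N) × ℝ)}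

lemma left_deriv_nonneg {h : ℝ → ℝ} {d : ℝ} (hd : HasDerivAt h d 0)
    (hle : ∀ᶠ ε : ℝ in 𝓝[<] 0, h ε ≤ h 0) : 0 ≤ d := by
  have h1 := (hasDerivAt_iff_tendsto_slope_left_right.1 hd).1
  refine ge_of_tendsto h1 ?_
  filter_upwards [hle, self_mem_nhdsWithin] with ε h2 h3
  rw [slope_def_field]
  have h4 : ε < 0 := h3
  exact div_nonneg_of_nonpos (by linarith) (by linarith)

/-- the squared spatial gradient of `ph` -/
def ww (D : ℝ) (u : EuclideanSpace ℝ (Fin N) × ℝ → ℝ) (p : EuclideanSpace ℝ (Fin N) × ℝ) : ℝ :=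
  ∑ j, pd (ee j) (ph D u) p ^ 2

lemma ww_smooth {D : ℝ} {u : EuclideanSpace ℝ (Fin N) × ℝ → ℝ} (hU : IsOpen U)
    (hu : ContDiff ℝ (⊤ : ℕ∞) u)
    (hpos : ∀ p ∈ U, 0 < u p) (hg : ∀ p ∈ U, 0 < gg D u p) : ContDiffOn ℝ (⊤ : ℕ∞) (ww D u) U :=
  ContDiffOn.sum fun i _ => (pd_smooth hU (ph_smooth hu hpos hg) (ee i)).pow 2

lemma hess_term {f : EuclideanSpace ℝ (Fin N) → ℝ} (hf : ContDiff ℝ (⊤ : ℕ∞) f) {κ : ℝ}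
    (hκ : ∀ x v, -(κ * ‖v‖ ^ 2) ≤ hess f x v v) (p : EuclideanSpace ℝ (Fin N) × ℝ) (a : Fin N → ℝ) :
    -(κ * ∑ i, a i ^ 2) ≤ ∑ i, ∑ j, pd (ee j) (pd (ee i) (fun p => f p.1)) p * a i * a j := by
  set v : EuclideanSpace ℝ (Fin N) := WithLp.toLp 2 a with hv
  have hva : ∀ i, v i = a i := fun i => rfl
  have h1 := hκ p.1 v
  have h2 := hess_eq (ext_smooth hf) p.1 v v p.2
  have h3 : pd (v, 0) (fun p : EuclideanSpace ℝ (Fin N) × ℝ => f p.1) =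
      fun p => ∑ i, a i * pd (ee i) (fun p : EuclideanSpace ℝ (Fin N) × ℝ => f p.1) p := by
    funext p; rw [pd_sum_dir]
  have hF := (ext_smooth hf).contDiffOn (s := univ)
  have hd : ∀ i, DifferentiableAt ℝ (pd (ee i) (fun p : EuclideanSpace ℝ (Fin N) × ℝ => f p.1)) p :=
    fun i => sm_diff isOpen_univ (pd_smooth isOpen_univ hF _) (mem_univ _)
  have h4 : pd (v, 0) (pd (v, 0) (fun p : EuclideanSpace ℝ (Fin N) × ℝ => f p.1)) p
      = ∑ i, ∑ j, pd (ee j) (pd (ee i) (fun p => f p.1)) p * a i * a j := by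
    rw [pd_sum_dir, h3, Finset.sum_comm]
    refine Finset.sum_congr rfl fun j _ => ?_
    have h5 : pd (ee j) (fun p => ∑ i, a i * pd (ee i)
        (fun p : EuclideanSpace ℝ (Fin N) × ℝ => f p.1) p) p
        = ∑ i, a i * pd (ee j) (pd (ee i) (fun p : EuclideanSpace ℝ (Fin N) × ℝ => f p.1)) p := by
      refine pd_eq (DifferentiableAt.fun_sum fun i _ => (hd i).const_mul _) ?_
      exact HasDerivAt.fun_sum fun i _ => (hline (ee j) (hd i)).const_mul (a i)
    rw [h5, hva, Finset.mul_sum]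
    refine Finset.sum_congr rfl fun i _ => ?_
    ring
  rw [← h4]
  have h6 : ‖v‖ ^ 2 = ∑ i, a i ^ 2 := norm_sum v
  rw [← h6]
  calc _ ≤ _ := h1
    _ = _ := h2

lemma react_term {a qq H : Fin N → ℝ} {E q0 g α Q G Dp w : ℝ} (hw : w = ∑ i, a i ^ 2)
    (hH : ∀ j, H j = E * (qq j / g - q0 * (α - 1) * a j - q0 * a j / g))
    (hE : 0 ≤ E) (hED : E ≤ Dp) (hg : 1 ≤ g) (hα : 1 ≤ α) (hQ : 0 ≤ Q) (hq : q0 ≤ Q) (hG : 0 ≤ G)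
    (hqG : ∑ j, qq j ^ 2 ≤ G ^ 2) :
    -((α * Dp * Q) * w + (Dp * G) * √w) ≤ ∑ j, a j * H j := by
  have hw0 : 0 ≤ w := hw ▸ Finset.sum_nonneg fun i _ => sq_nonneg _
  have e : ∑ j, a j * H j = E * ((∑ j, a j * qq j) / g - q0 * (α - 1 + 1 / g) * w) := by
    rw [hw, Finset.mul_sum, Finset.sum_div, ← Finset.sum_sub_distrib, Finset.mul_sum]
    refine Finset.sum_congr rfl fun j _ => ?_
    rw [hH]
    field_simp
    ring
  have hcs : |∑ j, a j * qq j| ≤ √w * G := by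
    have h1 := Finset.sum_mul_sq_le_sq_mul_sq Finset.univ a qq
    rw [← hw] at h1
    have h2 : (∑ j, a j * qq j) ^ 2 ≤ (√w * G) ^ 2 := by
      rw [mul_pow, Real.sq_sqrt hw0]
      exact h1.trans (mul_le_mul_of_nonneg_left hqG hw0)
    exact abs_le_of_sq_le_sq h2 (by positivity)
  have hg0 : 0 < g := by linarith
  have h3 : -(√w * G) ≤ (∑ j, a j * qq j) / g := by
    rw [le_div_iff₀ hg0]
    have : 0 ≤ √w * G := by positivity
    nlinarith [neg_le_of_abs_le hcs]
  have hg1 : 1 / g ≤ 1 := by rw [div_le_one hg0]; exact hg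
  have hg2 : 0 < 1 / g := by positivity
  have h4 : q0 * (α - 1 + 1 / g) * w ≤ Q * α * w := by
    have : q0 * (α - 1 + 1 / g) ≤ Q * α :=
      (mul_le_mul_of_nonneg_right hq (by linarith)).trans
        (mul_le_mul_of_nonneg_left (by linarith) hQ)
    exact mul_le_mul_of_nonneg_right this hw0
  rw [e]
  have h5 : E * (-(√w * G) - Q * α * w) ≤
      E * ((∑ j, a j * qq j) / g - q0 * (α - 1 + 1 / g) * w) :=
    mul_le_mul_of_nonneg_left (by linarith) hE
  have h6 : E * (√w * G + Q * α * w) ≤ Dp * (√w * G + Q * α * w) :=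
    mul_le_mul_of_nonneg_right hED (by positivity)
  linarith

lemma point_est {D α : ℝ} {u q : EuclideanSpace ℝ (Fin N) × ℝ → ℝ} (hU : IsOpen U)
    (hu : ContDiff ℝ (⊤ : ℕ∞) u) (hq : ContDiff ℝ (⊤ : ℕ∞) q)
    {f : EuclideanSpace ℝ (Fin N) → ℝ} (hf : ContDiff ℝ (⊤ : ℕ∞) f)
    (hpos : ∀ p ∈ U, 0 < u p) (hg : ∀ p ∈ U, 0 < gg D u p) {p} (hp : p ∈ U)
    {x₀ : EuclideanSpace ℝ (Fin N)} {R : ℝ} (hball : ‖p.1 - x₀‖ < R)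
    (hpde : ∀ x ∈ closedBall x₀ R, tderiv u (x, p.2) = swlap f u (x, p.2)
      + q (x, p.2) * u (x, p.2) ^ α)
    {θ : ℝ → ℝ} (hθ : ContDiff ℝ (⊤ : ℕ∞) θ)
    (hψ : 0 < cut θ x₀ R p) (hψ1 : cut θ x₀ R p ≤ 1) (hw : 0 < ww D u p) (hg1 : 1 ≤ gg D u p)
    {s k κ L Q G : ℝ} (hs : 0 < s) (hk : 0 ≤ k) (hκ0 : 0 ≤ κ) (hL : 0 ≤ L)
    (hD : 0 < D) (hα : 1 ≤ α) (hQ : 0 ≤ Q) (hG : 0 ≤ G)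
    (hmax : ∀ x ∈ closedBall x₀ R, cut θ x₀ R (x, p.2) * ww D u (x, p.2) ≤ cut θ x₀ R p * ww D u p)
    (htime : 0 ≤ ww D u p + s * pd (0, 1) (ww D u) p)
    (hκ : ∀ x v, -(κ * ‖v‖ ^ 2) ≤ hess f x v v)
    (hqQ : q p ≤ Q) (hqG : ∑ j, pd (ee j) q p ^ 2 ≤ G ^ 2)
    (h6 : ∑ i, pd (ee i) (cut θ x₀ R) p ^ 2 ≤ k ^ 2 * cut θ x₀ R p)
    (h7 : -L ≤ ∑ i, pd (ee i) (pd (ee i) (cut θ x₀ R)) p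
      - ∑ i, pd (ee i) (fun p => f p.1) p * pd (ee i) (cut θ x₀ R) p) :
    √(cut θ x₀ R p * ww D u p) ^ 3 ≤ k * √(cut θ x₀ R p * ww D u p) ^ 2
      + (L / 2 + k ^ 2 + 1 / (2 * s) + κ + α * D ^ (α - 1) * Q) * √(cut θ x₀ R p * ww D u p)
      + D ^ (α - 1) * G := by
  have hφ := ph_smooth (D := D) hu hpos hg
  have hφi := fun i : Fin N => pd_smooth hU hφ (ee i)
  have hws := ww_smooth hU hu hpos hg
  have hcs := (cut_smooth hθ x₀ R).contDiffOn (s := U)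
  have hDp : 0 < D ^ (α - 1) := Real.rpow_pos_of_pos hD _
  -- points near `p` in spatial directions
  have hnear : ∀ i : Fin N, ∀ᶠ ε : ℝ in 𝓝 0, (p + ε • ee i).1 ∈ closedBall x₀ R := by
    intro i
    have hc : ContinuousAt (fun ε : ℝ => ‖(p + ε • ee i).1 - x₀‖) 0 := by fun_prop
    have := hc.eventually_lt_const (u := R) (by simpa using hball)
    filter_upwards [this] with ε h
    rw [mem_closedBall, dist_eq_norm]; exact h.le
  have hsnd : ∀ (i : Fin N) (ε : ℝ), p + ε • ee i = ((p + ε • ee i).1, p.2) := by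
    intro i ε; ext1
    · rfl
    · simp [ee]
  have htest : ∀ i : Fin N, pd (ee i) (fun p => cut θ x₀ R p * ww D u p) p = 0 ∧
      pd (ee i) (pd (ee i) (fun p => cut θ x₀ R p * ww D u p)) p ≤ 0 := by
    intro i
    refine second_test hU (hcs.mul hws) hp ?_
    filter_upwards [hnear i] with ε hε
    have := hmax _ hε
    rw [← hsnd i ε] at this
    simpa using this
  have hw1 : ∀ v, pd v (ww D u) p = 2 * ∑ j, pd (ee j) (ph D u) p * pd v (pd (ee j) (ph D u)) p :=
    fun v => pd_sumsq hU hφi hp v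
  have hw2 : ∀ v, pd v (pd v (ww D u)) p = 2 * ∑ j, (pd v (pd (ee j) (ph D u)) p ^ 2
      + pd (ee j) (ph D u) p * pd v (pd v (pd (ee j) (ph D u))) p) :=
    fun v => pd_sumsq2 hU hφi hp v
  have hcomm3 : ∀ i j : Fin N, pd (ee j) (pd (ee i) (pd (ee i) (ph D u))) p =
      pd (ee i) (pd (ee i) (pd (ee j) (ph D u))) p := by
    intro i j
    rw [pd_comm hU (hφi i) hp]
    exact pd_congr hU (fun y hy => pd_comm hU hφ hy _ _) hp _
  have hE : Real.exp ((α - 1) * (1 + Real.log D - gg D u p)) ≤ D ^ (α - 1) := by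
    rw [Real.rpow_def_of_pos hD, Real.exp_le_exp, mul_comm]
    exact mul_le_mul_of_nonneg_right (by linarith) (by linarith)
  refine alg (N := N)
    (a := fun j => pd (ee j) (ph D u) p) (p := fun i => pd (ee i) (cut θ x₀ R) p)
    (pp := fun i => pd (ee i) (pd (ee i) (cut θ x₀ R)) p)
    (m := fun i => pd (ee i) (fun p => f p.1) p)
    (d := fun j => pd (ee j) (pd (0, 1) (ph D u)) p)
    (H := fun j => Real.exp ((α - 1) * (1 + Real.log D - gg D u p)) *
        (pd (ee j) q p / gg D u p - q p * (α - 1) * pd (ee j) (ph D u) p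
          - q p * pd (ee j) (ph D u) p / gg D u p))
    (b := fun i j => pd (ee i) (pd (ee j) (ph D u)) p)
    (c := fun i j => pd (ee i) (pd (ee i) (pd (ee j) (ph D u))) p)
    (h := fun i j => pd (ee j) (pd (ee i) (fun p => f p.1)) p)
    (g := gg D u p) hψ hψ1 hw hg1 hs hk hκ0 (by positivity) (by positivity) hL rfl ?_ ?_ ?_ ?_ ?_ ?_
    h6 h7
  · intro j
    have := ph_pde_pd (D := D) (α := α) hU hu hq hf hpos hg hp j (by
      filter_upwards [hnear j] with ε hε
      have := hpde _ hε
      rwa [← hsnd j ε] at this)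
    rw [this]
    congr 2
    · congr 1
      refine Finset.sum_congr rfl fun i _ => ?_
      rw [hcomm3, pd_comm hU hφ hp (ee j) (ee i)]
    · refine Finset.sum_congr rfl fun i _ => ?_
      rw [pd_comm hU hφ hp (ee j) (ee i)]
  · intro i
    have := (htest i).1
    rw [pd_mul hU hcs hws hp, hw1] at this
    exact this
  · intro i
    have := (htest i).2
    rw [pd_mul2 hU hcs hws hp, hw1, hw2] at this
    exact this
  · rw [hw1] at htime
    refine htime.trans_eq ?_
    congr 3
    refine Finset.sum_congr rfl fun j _ => ?_
    rw [pd_comm hU hφ hp]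
  · exact hess_term hf hκ p _
  · exact react_term rfl (fun j => rfl) (Real.exp_nonneg _) hE hg1 hα hQ hqQ hG hqG

end point

section final
variable {N : ℕ}

set_option maxHeartbeats 800000 in
lemma scalar_fin {c n R M K A1 b0 X1 X3 X4 X5 s z : ℝ} (hc : 1 ≤ c) (hn : 1 ≤ n) (hR : 2 ≤ R)
    (hK : 0 ≤ K) (hM : 0 ≤ M)
    (hX1 : X1 = √((1 + M) / R)) (hX3 : X3 = √K) (hX4 : 0 ≤ X4) (hX4' : X4 ^ 2 = A1)
    (hX5 : 0 ≤ X5) (hX5' : X5 ^ 3 = b0) (hs : 0 < s) (hz : 0 ≤ z)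
    (h : z ^ 3 ≤ (2 * c / R) * z ^ 2
      + ((c * (4 * n * ((1 + M) / R) + 2 * ((n - 1) * K))) / 2 + (2 * c / R) ^ 2 + 1 / (2 * s)
        + (n - 1) * K + A1) * z + b0) :
    z ≤ 3 * (4 * c * n * (X1 + X3 + X4 + X5 + 1 / √s)) := by
  have hR0 : 0 < R := by linarith
  set Y := 1 / √s with hY
  have hY0 : 0 < Y := by positivity
  have hY2 : 1 / s = Y ^ 2 := by rw [hY, div_pow, Real.sq_sqrt hs.le]; simp
  have hX10 : 0 ≤ X1 := hX1 ▸ Real.sqrt_nonneg _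
  have hX30 : 0 ≤ X3 := hX3 ▸ Real.sqrt_nonneg _
  have hX12 : (1 + M) / R = X1 ^ 2 := by rw [hX1, Real.sq_sqrt (by positivity)]
  have hX32 : K = X3 ^ 2 := by rw [hX3, Real.sq_sqrt hK]
  have hiR : 1 / R ≤ X1 := by
    refine le_of_sq_le_sq ?_ hX10
    rw [← hX12, div_pow, one_pow, div_le_div_iff₀ (by positivity) hR0]
    nlinarith
  have hiR0 : 0 < 1 / R := by positivity
  have hk : 2 * c / R = 2 * c * (1 / R) := by ring
  have hkX : 2 * c / R ≤ 2 * c * X1 := by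
    rw [hk]; exact mul_le_mul_of_nonneg_left hiR (by linarith)
  have hk0 : 0 ≤ 2 * c / R := by positivity
  have hcn : 1 ≤ c * n := one_le_mul_of_one_le_of_one_le hc hn
  have hccn : c ≤ c * n := le_mul_of_one_le_right (by linarith only [hc]) hn
  set W := X1 + X3 + X4 + X5 + Y with hW
  have hW0 : 0 ≤ W := by positivity
  have hWW : W ≤ 4 * c * n * W := by
    have : (0:ℝ) ≤ (4 * (c * n) - 1) * W := mul_nonneg (by linarith) hW0
    linarith
  refine root_bound hz (by positivity) ?_ ?_ ?_ h
  · have h1 : 2 * c * X1 ≤ 4 * c * n * X1 := by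
      have : 0 ≤ (4 * (c * n) - 2 * c) * X1 := mul_nonneg (by linarith) hX10
      linarith
    have h2 : 4 * c * n * X1 ≤ 4 * c * n * W :=
      mul_le_mul_of_nonneg_left (by rw [hW]; linarith) (by positivity)
    linarith
  · have hk2 : (2 * c / R) ^ 2 ≤ 4 * c ^ 2 * X1 ^ 2 := by
      have := pow_le_pow_left₀ hk0 hkX 2
      calc _ ≤ _ := this
        _ = _ := by ring
    have hWsq : X1 ^ 2 + X3 ^ 2 + X4 ^ 2 + Y ^ 2 ≤ W ^ 2 := by
      have e : W ^ 2 - (X1 ^ 2 + X3 ^ 2 + X4 ^ 2 + Y ^ 2) = X5 ^ 2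
        + 2 * (X1 * X3 + X1 * X4 + X1 * X5 + X1 * Y + X3 * X4 + X3 * X5 + X3 * Y + X4 * X5
          + X4 * Y + X5 * Y) := by rw [hW]; ring
      have : 0 ≤ X5 ^ 2
        + 2 * (X1 * X3 + X1 * X4 + X1 * X5 + X1 * Y + X3 * X4 + X3 * X5 + X3 * Y + X4 * X5
          + X4 * Y + X5 * Y) := by positivity
      linarith
    have hcc : c ^ 2 ≤ (c * n) ^ 2 := pow_le_pow_left₀ (by linarith) hccn 2
    have hc2 : c * n ≤ (c * n) ^ 2 := le_self_pow₀ hcn (by norm_num)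
    have hp1 : 1 ≤ (c * n) ^ 2 := one_le_pow₀ hcn
    have hnc : n ≤ c * n := le_mul_of_one_le_left (by linarith only [hn]) hc
    have e1 : (2 * (c * n) + 4 * c ^ 2) * X1 ^ 2 ≤ 16 * (c * n) ^ 2 * X1 ^ 2 :=
      mul_le_mul_of_nonneg_right (by linarith) (sq_nonneg _)
    have e3 : (c * (n - 1) + (n - 1)) * X3 ^ 2 ≤ 16 * (c * n) ^ 2 * X3 ^ 2 :=
      mul_le_mul_of_nonneg_right (by linarith) (sq_nonneg _)
    have e4 : X4 ^ 2 ≤ 16 * (c * n) ^ 2 * X4 ^ 2 := by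
      have : 0 ≤ (16 * (c * n) ^ 2 - 1) * X4 ^ 2 := mul_nonneg (by linarith) (sq_nonneg _)
      linarith
    have e5 : Y ^ 2 / 2 ≤ 16 * (c * n) ^ 2 * Y ^ 2 := by
      have : 0 ≤ (16 * (c * n) ^ 2 - 1 / 2) * Y ^ 2 := mul_nonneg (by linarith) (sq_nonneg _)
      linarith
    have e6 : 16 * (c * n) ^ 2 * (X1 ^ 2 + X3 ^ 2 + X4 ^ 2 + Y ^ 2) ≤ 16 * (c * n) ^ 2 * W ^ 2 :=
      mul_le_mul_of_nonneg_left hWsq (by positivity)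
    have e7 : 1 / (2 * s) = Y ^ 2 / 2 := by rw [← hY2]; field_simp
    rw [e7, hX12, hX32, ← hX4']
    have e8 : (4 * c * n * W) ^ 2 = 16 * (c * n) ^ 2 * W ^ 2 := by ring
    rw [e8]
    linarith
  · rw [← hX5']
    exact pow_le_pow_left₀ hX5 (by linarith [show X5 ≤ W by rw [hW]; linarith]) 3

lemma sgrad_norm {q : EuclideanSpace ℝ (Fin N) × ℝ → ℝ} (hq : ContDiff ℝ (⊤ : ℕ∞) q)
    (p : EuclideanSpace ℝ (Fin N) × ℝ) : ‖sgrad q p‖ ^ 2 = ∑ j, pd (ee j) q p ^ 2 := by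
  rw [norm_sum]
  refine Finset.sum_congr rfl fun j _ => ?_
  unfold sgrad
  rw [grad_coord ((hq.differentiable (by simp)) _)]

lemma sgrad_cont {q : EuclideanSpace ℝ (Fin N) × ℝ → ℝ} (hq : ContDiff ℝ (⊤ : ℕ∞) q) :
    Continuous (fun p => ‖sgrad q p‖) := by
  have : (fun p => ‖sgrad q p‖) = fun p => √(∑ j, pd (ee j) q p ^ 2) := by
    funext p; rw [← sgrad_norm hq, Real.sqrt_sq (norm_nonneg _)]
  rw [this]
  refine Continuous.sqrt (continuous_finsetSum _ fun j _ => Continuous.pow ?_ 2)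
  exact continuousOn_univ.1 (pd_smooth isOpen_univ hq.contDiffOn _).continuousOn

lemma cyl_compact (x₀ : EuclideanSpace ℝ (Fin N)) (R t₀ T : ℝ) : IsCompact (cyl x₀ R t₀ T) :=
  (isCompact_closedBall _ _).prod isCompact_Icc

lemma core (hN : 1 ≤ N) {θ : ℝ → ℝ} {c : ℝ} (hc : 1 ≤ c) (hθ : ContDiff ℝ (⊤ : ℕ∞) θ)
    (hθ1 : ∀ x ≤ 1 / 4, θ x = 1) (hθz : ∀ x, 1 ≤ x → θ x = 0) (hθ0 : ∀ x, 0 ≤ θ x)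
    (hθle : ∀ x, θ x ≤ 1) (hθd : ∀ x, deriv θ x ≤ 0)
    (hθ2 : ∀ x ∈ Icc (0 : ℝ) 1, deriv θ x ^ 2 ≤ c * θ x)
    (hθ3 : ∀ x ∈ Icc (0 : ℝ) 1, |deriv θ x| ≤ c) (hθ4 : ∀ x ∈ Icc (0 : ℝ) 1, |deriv (deriv θ) x| ≤ c)
    {K : ℝ} (hK : 0 ≤ K) {f : EuclideanSpace ℝ (Fin N) → ℝ} (hf : ContDiff ℝ (⊤ : ℕ∞) f)
    (hκ : ∀ x v, -(((N : ℝ) - 1) * K * ‖v‖ ^ 2) ≤ hess f x v v)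
    {x₀ : EuclideanSpace ℝ (Fin N)} {R : ℝ} (hR : 2 ≤ R) {t₀ T : ℝ}
    {q : EuclideanSpace ℝ (Fin N) × ℝ → ℝ} (hq : ContDiff ℝ (⊤ : ℕ∞) q) {α : ℝ} (hα : 1 ≤ α)
    {u : EuclideanSpace ℝ (Fin N) × ℝ → ℝ} (hu : ContDiff ℝ (⊤ : ℕ∞) u) {D : ℝ} (hD : 0 < D)
    (hpos : ∀ p ∈ cyl x₀ R t₀ T, 0 < u p) (hle : ∀ p ∈ cyl x₀ R t₀ T, u p ≤ D)
    (hpde : ∀ p ∈ cyl x₀ R t₀ T, tderiv u p = swlap f u p + q p * u p ^ α)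
    {p} (hp : p ∈ cyl x₀ (R / 2) t₀ T) (hpt : p.2 ≠ t₀ - T)
    {M Q G X4 X5 : ℝ}
    (hM : ∀ y ∈ sphere x₀ 1, ((N : ℝ) - 1) - ⟪gradient f y, y - x₀⟫ ≤ M)
    (hQ : 0 ≤ Q) (hqQ : ∀ p ∈ cyl x₀ R t₀ T, q p ≤ Q)
    (hG : 0 ≤ G) (hqG : ∀ p ∈ cyl x₀ R t₀ T, ‖sgrad q p‖ ≤ G)
    (hX4 : 0 ≤ X4) (hX4' : X4 ^ 2 = α * D ^ (α - 1) * Q)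
    (hX5 : 0 ≤ X5) (hX5' : X5 ^ 3 = D ^ (α - 1) * G) :
    ‖sgrad u p‖ / u p ≤ 3 * (4 * c * N) * (√((1 + |M|) / R) + 1 / √(p.2 - (t₀ - T)) + √K + X4 + X5)
      * gg D u p := by
  have hN1 : (1 : ℝ) ≤ N := by exact_mod_cast hN
  have hR0 : 0 < R := by linarith
  set a := t₀ - T with ha
  obtain ⟨hpx, hpt1⟩ := hp
  have hst : 0 < p.2 - a := by
    have := lt_of_le_of_ne hpt1.1 (Ne.symm hpt); linarith
  -- the open set
  set U : Set (EuclideanSpace ℝ (Fin N) × ℝ) := {p | 0 < u p ∧ u p < D * Real.exp 1} with hUdef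
  have huc := hu.continuous
  have hU : IsOpen U := (isOpen_lt continuous_const huc).inter (isOpen_lt huc continuous_const)
  have hUpos : ∀ p ∈ U, 0 < u p := fun p hp => hp.1
  have hUg : ∀ p ∈ U, 0 < gg D u p := by
    intro p hp
    have h1 := Real.log_lt_log hp.1 hp.2
    rw [Real.log_mul hD.ne' (Real.exp_pos 1).ne', Real.log_exp] at h1
    unfold gg; linarith
  have hcU : cyl x₀ R t₀ T ⊆ U := by
    intro p hp
    refine ⟨hpos p hp, (hle p hp).trans_lt ?_⟩
    have : 1 < Real.exp 1 := by simp
    nlinarith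
  have hg1 : ∀ p ∈ cyl x₀ R t₀ T, 1 ≤ gg D u p := by
    intro p hp
    have := Real.log_le_log (hpos p hp) (hle p hp)
    unfold gg; linarith
  have hws := ww_smooth hU hu hUpos hUg
  have hww0 : ∀ p, 0 ≤ ww D u p := fun p => Finset.sum_nonneg fun i _ => sq_nonneg _
  set S : Set (EuclideanSpace ℝ (Fin N) × ℝ) := closedBall x₀ R ×ˢ Icc a p.2 with hS
  have hSc : IsCompact S := (isCompact_closedBall _ _).prod isCompact_Icc
  have hSsub : S ⊆ cyl x₀ R t₀ T := prod_mono_right (Icc_subset_Icc_right hpt1.2)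
  have hpS : p ∈ S := ⟨closedBall_subset_closedBall (by linarith) hpx, hpt1.1, le_rfl⟩
  have hFc : ContinuousOn (fun y : EuclideanSpace ℝ (Fin N) × ℝ =>
      (y.2 - a) * (cut θ x₀ R y * ww D u y)) S :=
    ContinuousOn.mul (by fun_prop) (((cut_smooth hθ x₀ R).continuous.continuousOn).mul
      (hws.continuousOn.mono (hSsub.trans hcU)))
  obtain ⟨p1, hp1S, hp1max⟩ := hSc.exists_isMaxOn ⟨p, hpS⟩ hFc
  have hcutp : cut θ x₀ R p = 1 := by
    unfold cut
    apply hθ1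
    rw [mem_closedBall, dist_eq_norm] at hpx
    rw [div_le_iff₀ (by positivity)]
    nlinarith [norm_nonneg (p.1 - x₀)]
  have hpp1 : (p.2 - a) * ww D u p ≤ (p1.2 - a) * (cut θ x₀ R p1 * ww D u p1) := by
    have : (p.2 - a) * (cut θ x₀ R p * ww D u p) ≤ (p1.2 - a) * (cut θ x₀ R p1 * ww D u p1) :=
      hp1max hpS
    rwa [hcutp, one_mul] at this
  set X1 := √((1 + |M|) / R) with hX1
  set X3 := √K with hX3
  have hX10 : 0 ≤ X1 := Real.sqrt_nonneg _
  have hX30 : 0 ≤ X3 := Real.sqrt_nonneg _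
  have hcN : 0 < 4 * c * N := by positivity
  have hs1 : p1.2 - a ≤ p.2 - a := by linarith [hp1S.2.2]
  have hs10 : 0 ≤ p1.2 - a := by linarith [hp1S.2.1]
  have hcut0 : 0 ≤ cut θ x₀ R p1 := hθ0 _
  have key : √(ww D u p) ≤ 3 * (4 * c * N) * (X1 + 1 / √(p.2 - a) + X3 + X4 + X5) := by
    by_cases h0 : (p1.2 - a) * (cut θ x₀ R p1 * ww D u p1) ≤ 0
    · have : ww D u p ≤ 0 := by
        by_contra hcon
        push Not at hcon
        have := mul_pos hst hcon
        linarith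
      rw [Real.sqrt_eq_zero_of_nonpos this]
      positivity
    push Not at h0
    have hs1pos : 0 < p1.2 - a := by
      rcases hs10.lt_or_eq with h | h
      · exact h
      · rw [← h, zero_mul] at h0; exact absurd h0 (lt_irrefl _)
    have hcw : 0 < cut θ x₀ R p1 * ww D u p1 := pos_of_mul_pos_right h0 hs10
    have hwpos : 0 < ww D u p1 := pos_of_mul_pos_right hcw hcut0
    have hcpos : 0 < cut θ x₀ R p1 := pos_of_mul_pos_left hcw (hww0 _)
    have hball : ‖p1.1 - x₀‖ < R := by
      by_contra hcon
      push Not at hcon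
      have : cut θ x₀ R p1 = 0 := by
        unfold cut
        apply hθz
        rw [le_div_iff₀ (by positivity), one_mul]
        exact pow_le_pow_left₀ hR0.le hcon 2
      linarith
    have hp1c := hSsub hp1S
    have hp1U := hcU hp1c
    have htime : 0 ≤ ww D u p1 + (p1.2 - a) * pd (0, 1) (ww D u) p1 := by
      have hd1 := hline (0, 1) (sm_diff hU hws hp1U)
      have hd2 : HasDerivAt (fun ε : ℝ => (p1.2 - a) + ε) 1 0 := (hasDerivAt_id (0 : ℝ)).const_add _
      have hd := (hd2.fun_mul hd1).congr_deriv
        (g' := ww D u p1 + (p1.2 - a) * pd (0, 1) (ww D u) p1) (by simp)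
      refine left_deriv_nonneg hd ?_
      have hev : ∀ᶠ ε : ℝ in 𝓝[<] 0, -(p1.2 - a) < ε :=
        nhdsWithin_le_nhds (lt_mem_nhds (by linarith))
      filter_upwards [hev, self_mem_nhdsWithin] with ε h1 h2
      have h2' : ε < 0 := h2
      have hmem : p1 + ε • ((0, 1) : EuclideanSpace ℝ (Fin N) × ℝ) ∈ S := by
        refine ⟨?_, ?_, ?_⟩
        · simpa using hp1S.1
        · simp; linarith
        · have := hp1S.2.2
          simp; linarith
      have h3 := hp1max hmem
      simp only [Set.mem_ofPred_eq] at h3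
      have h4 : cut θ x₀ R (p1 + ε • ((0, 1) : EuclideanSpace ℝ (Fin N) × ℝ)) = cut θ x₀ R p1 := by
        unfold cut; simp
      rw [h4] at h3
      have h5 : (p1 + ε • ((0, 1) : EuclideanSpace ℝ (Fin N) × ℝ)).2 - a = p1.2 - a + ε := by
        simp; ring
      rw [h5] at h3
      simp only [zero_smul, add_zero]
      refine le_of_mul_le_mul_left ?_ hcpos
      linarith
    have hest := point_est (D := D) (α := α) hU hu hq hf hUpos hUg hp1U hball
      (fun x hx => hpde (x, p1.2) ⟨hx, hp1c.2⟩) hθ hcpos (hθle _) hwpos (hg1 _ hp1c)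
      (s := p1.2 - a) (k := 2 * c / R) (κ := ((N : ℝ) - 1) * K)
      (L := c * (4 * N * ((1 + |M|) / R) + 2 * (((N : ℝ) - 1) * K))) (Q := Q) (G := G)
      hs1pos (by positivity) (mul_nonneg (by linarith) hK)
      (by have : 0 ≤ ((N : ℝ) - 1) * K := mul_nonneg (by linarith) hK
          positivity) hD hα hQ hG
      (fun x hx => by
        have h3 : (p1.2 - a) * (cut θ x₀ R (x, p1.2) * ww D u (x, p1.2)) ≤
          (p1.2 - a) * (cut θ x₀ R p1 * ww D u p1) := hp1max (show (x, p1.2) ∈ S from ⟨hx, hp1S.2⟩)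
        exact le_of_mul_le_mul_left h3 hs1pos) htime hκ (hqQ _ hp1c)
      (by rw [← sgrad_norm hq]; exact pow_le_pow_left₀ (norm_nonneg _) (hqG _ hp1c) 2)
      (cut_grad hθ hc hθ2 hθ0 x₀ hR p1 hball.le)
      (cut_lap hf (mul_nonneg (by linarith) hK) hκ hM hN hθ hc hθ1 hθd hθ3 hθ4 hR p1 hball.le)
    have hz := scalar_fin (X1 := X1) (X3 := X3) hc hN1 hR hK (abs_nonneg M) hX1 hX3 hX4 hX4' hX5 hX5' hs1pos
      (Real.sqrt_nonneg _) hest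
    -- conclude
    set z := √(cut θ x₀ R p1 * ww D u p1) with hzdef
    have hz0 : 0 ≤ z := Real.sqrt_nonneg _
    set r1 := √(p1.2 - a) with hr1
    set r := √(p.2 - a) with hr
    have hr10 : 0 < r1 := Real.sqrt_pos.2 hs1pos
    have hr0 : 0 < r := Real.sqrt_pos.2 hst
    have hrr : r1 ≤ r := Real.sqrt_le_sqrt hs1
    have h1 : r * √(ww D u p) ≤ r1 * z := by
      rw [hr, hr1, hzdef, ← Real.sqrt_mul hst.le, ← Real.sqrt_mul hs10]
      exact Real.sqrt_le_sqrt hpp1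
    have h2 : r1 * z ≤ r1 * (3 * (4 * c * N * (X1 + X3 + X4 + X5 + 1 / r1))) :=
      mul_le_mul_of_nonneg_left hz hr10.le
    have h3 : r1 * (3 * (4 * c * N * (X1 + X3 + X4 + X5 + 1 / r1))) =
        3 * (4 * c * N) * (r1 * (X1 + X3 + X4 + X5) + 1) := by field_simp
    have h4 : 3 * (4 * c * N) * (r1 * (X1 + X3 + X4 + X5) + 1) ≤
        3 * (4 * c * N) * (r * (X1 + X3 + X4 + X5) + 1) := by gcongr
    have h5 : 3 * (4 * c * N) * (r * (X1 + X3 + X4 + X5) + 1) =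
        r * (3 * (4 * c * N) * (X1 + 1 / r + X3 + X4 + X5)) := by field_simp; ring
    refine le_of_mul_le_mul_left ?_ hr0
    linarith
  have hpc := hSsub hpS
  have hup := hpos p hpc
  have hgp := hUg p (hcU hpc)
  have hid : ‖sgrad u p‖ / u p = √(ww D u p) * gg D u p := by
    have e : ww D u p = (‖sgrad u p‖ / (u p * gg D u p)) ^ 2 := by
      rw [div_pow, sgrad_norm hu, Finset.sum_div]
      unfold ww
      refine Finset.sum_congr rfl fun j _ => ?_
      rw [ph_pd hU hu hUpos hUg (hcU hpc), gg_pd hU hu hUpos (hcU hpc)]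
      field_simp
    rw [e, Real.sqrt_sq (by positivity)]
    field_simp
  rw [hid]
  exact mul_le_mul_of_nonneg_right key hgp.le

end final

end EGE

/-- **Theorem 1.1(1), Euclidean case.** Elliptic gradient estimate for positive bounded
solutions of `∂ₜ u = Δ_f u + q uᵅ` with `α ≥ 1`. -/
theorem elliptic_gradient_estimate_alpha_ge_one (N : ℕ) :
    ∃ C : ℝ, 0 < C ∧
      ∀ (K : ℝ), 0 ≤ K →
      ∀ (f : EuclideanSpace ℝ (Fin N) → ℝ), ContDiff ℝ (⊤ : ℕ∞) f →
      (∀ x v, -(((N : ℝ) - 1) * K * ‖v‖ ^ 2) ≤ hess f x v v) →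
      ∀ (x₀ : EuclideanSpace ℝ (Fin N)) (R : ℝ), 2 ≤ R →
      ∀ (t₀ T : ℝ), 0 < T →
      ∀ (q : EuclideanSpace ℝ (Fin N) × ℝ → ℝ), ContDiff ℝ (⊤ : ℕ∞) q →
      ∀ (α : ℝ), 1 ≤ α →
      ∀ (u : EuclideanSpace ℝ (Fin N) × ℝ → ℝ), ContDiff ℝ (⊤ : ℕ∞) u →
      ∀ (D : ℝ), 0 < D →
      (∀ p ∈ cyl x₀ R t₀ T, 0 < u p) →
      (∀ p ∈ cyl x₀ R t₀ T, u p ≤ D) →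
      (∀ p ∈ cyl x₀ R t₀ T, tderiv u p = swlap f u p + q p * u p ^ α) →
      ∀ p ∈ cyl x₀ (R / 2) t₀ T, p.2 ≠ t₀ - T →
        ‖sgrad u p‖ / u p ≤
          C * (Real.sqrt ((1 + |muConst f x₀|) / R)
              + 1 / Real.sqrt (p.2 - (t₀ - T))
              + Real.sqrt K
              + Real.sqrt α * D ^ ((α - 1) / 2) *
                (sSup ((fun p' => max (q p') 0) '' cyl x₀ R t₀ T)) ^ ((1 : ℝ) / 2)
              + D ^ ((α - 1) / 3) *
                (sSup ((fun p' => ‖sgrad q p'‖) '' cyl x₀ R t₀ T)) ^ ((1 : ℝ) / 3))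
            * ((sSup ((fun p' => |Real.log (u p' / D)|) '' cyl x₀ (R / 2) t₀ T) + 1)
                + Real.log (D / u p)) := by
  obtain ⟨c, hc, θ, hθ, hθ1, hθz, hθ0, hθle, hθd, hθ2, hθ3, hθ4⟩ := EGE.exists_cutoff
  refine ⟨3 * (4 * c * N) + 1, by positivity, ?_⟩
  intro K hK f hf hκ x₀ R hR t₀ T hT q hq α hα u hu D hD hpos hle hpde p hp hpt
  have hR0 : 0 < R := by linarith
  have hpc : p ∈ cyl x₀ R t₀ T :=
    ⟨closedBall_subset_closedBall (by linarith) hp.1, hp.2⟩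
  have hup := hpos p hpc
  have hlog : 0 ≤ Real.log (D / u p) :=
    Real.log_nonneg ((one_le_div hup).2 (hle p hpc))
  have hβ : 0 ≤ sSup ((fun p' => |Real.log (u p' / D)|) '' cyl x₀ (R / 2) t₀ T) :=
    Real.sSup_nonneg (by rintro _ ⟨y, _, rfl⟩; exact abs_nonneg _)
  set Q := sSup ((fun p' => max (q p') 0) '' cyl x₀ R t₀ T) with hQdef
  set G := sSup ((fun p' => ‖sgrad q p'‖) '' cyl x₀ R t₀ T) with hGdef
  have hQ : 0 ≤ Q := Real.sSup_nonneg (by rintro _ ⟨y, _, rfl⟩; exact le_max_right _ _)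
  have hG : 0 ≤ G := Real.sSup_nonneg (by rintro _ ⟨y, _, rfl⟩; exact norm_nonneg _)
  have hX4 : 0 ≤ √α * D ^ ((α - 1) / 2) * Q ^ ((1 : ℝ) / 2) := by positivity
  have hX5 : 0 ≤ D ^ ((α - 1) / 3) * G ^ ((1 : ℝ) / 3) := by positivity
  set Z := Real.sqrt ((1 + |muConst f x₀|) / R) + 1 / Real.sqrt (p.2 - (t₀ - T)) + Real.sqrt K
      + √α * D ^ ((α - 1) / 2) * Q ^ ((1 : ℝ) / 2) + D ^ ((α - 1) / 3) * G ^ ((1 : ℝ) / 3) with hZ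
  have hZ0 : 0 ≤ Z := by positivity
  rcases Nat.eq_zero_or_pos N with h0 | hN
  · subst h0
    have : sgrad u p = 0 := Subsingleton.elim _ _
    rw [this, norm_zero, zero_div]
    positivity
  have hcomp := EGE.cyl_compact x₀ R t₀ T
  have hQb : BddAbove ((fun p' => max (q p') 0) '' cyl x₀ R t₀ T) :=
    hcomp.bddAbove_image (hq.continuous.max continuous_const).continuousOn
  have hGb : BddAbove ((fun p' => ‖sgrad q p'‖) '' cyl x₀ R t₀ T) :=
    hcomp.bddAbove_image (EGE.sgrad_cont hq).continuousOn
  have hMb : BddAbove ((fun x => ((N : ℝ) - 1) - ⟪gradient f x, x - x₀⟫) '' sphere x₀ 1) := by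
    refine (isCompact_sphere x₀ 1).bddAbove_image (Continuous.continuousOn ?_)
    have := (EGE.grad_diff hf).continuous
    fun_prop
  have hX4' : (√α * D ^ ((α - 1) / 2) * Q ^ ((1 : ℝ) / 2)) ^ 2 = α * D ^ (α - 1) * Q := by
    rw [mul_pow, mul_pow, Real.sq_sqrt (by linarith), ← Real.rpow_mul_natCast hD.le,
      ← Real.rpow_mul_natCast hQ]
    norm_num
  have hX5' : (D ^ ((α - 1) / 3) * G ^ ((1 : ℝ) / 3)) ^ 3 = D ^ (α - 1) * G := by
    rw [mul_pow, ← Real.rpow_mul_natCast hD.le, ← Real.rpow_mul_natCast hG]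
    norm_num
  have h := EGE.core hN hc hθ hθ1 hθz hθ0 hθle hθd hθ2 hθ3 hθ4 hK hf hκ hR hq hα hu hD hpos hle
    hpde hp hpt (M := muConst f x₀)
    (fun y hy => le_csSup hMb ⟨y, hy, rfl⟩) hQ
    (fun y hy => (le_max_left _ _).trans (le_csSup hQb ⟨y, hy, rfl⟩)) hG
    (fun y hy => le_csSup hGb ⟨y, hy, rfl⟩) hX4 hX4' hX5 hX5'
  have hgg : EGE.gg D u p = 1 + Real.log (D / u p) := by
    unfold EGE.gg; rw [Real.log_div hD.ne' hup.ne']; ring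
  rw [hgg] at h
  refine h.trans ?_
  have hcN : 0 ≤ 3 * (4 * c * (N : ℝ)) := by positivity
  exact mul_le_mul (mul_le_mul_of_nonneg_right (by linarith) hZ0) (by linarith) (by linarith)
    (mul_nonneg (by linarith) hZ0)
end
end

section
/- Let f : ℝ^N → ℝ be smooth with ∇²f(v,v) ≥ 0 for all vectors v, and fix x₀ ∈ ℝ^N. Let α > 1 and let q : ℝ^N → ℝ be a smooth time-independent function which is not identically zero and satisfies sup_{B(x₀,R)} q⁺ = o(R^{−(α−1)}) and sup_{B(x₀,R)} |∇q| = o(R^{−(α−1)}) as R → ∞. Then there is no smooth positive ancient solution u of ∂ₜu = Δ_f u + q·u^α on ℝ^N × (−∞, 0] satisfying u(x,t) = o(|x−x₀|^{1/2} + |t|^{1/4}) near infinity. -/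
open Real Set Metric Filter
open scoped RealInnerProductSpace Topology

noncomputable section

/-- The "near infinity" filter on space-time `ℝ^N × (−∞,0]`: `|x − x₀| + |t| → ∞`
within the region `t ≤ 0`. -/
def ancientAtInfty {N : ℕ} (x₀ : EuclideanSpace ℝ (Fin N)) :
    Filter (EuclideanSpace ℝ (Fin N) × ℝ) :=
  (Filter.comap (fun p => ‖p.1 - x₀‖ + |p.2|) Filter.atTop) ⊓ 𝓟 {p | p.2 ≤ 0}

/-- A nonnegative continuous function whose sup over balls decays is zero. -/
lemma aux_zero {N : ℕ} (g : EuclideanSpace ℝ (Fin N) → ℝ) (hg : Continuous g)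
    (x₀ : EuclideanSpace ℝ (Fin N)) (β : ℝ) (hβ : 0 < β)
    (h : Filter.Tendsto (fun R : ℝ => sSup (g '' closedBall x₀ R) * R ^ β)
      Filter.atTop (𝓝 0)) (x : EuclideanSpace ℝ (Fin N)) : g x ≤ 0 := by
  by_contra hx
  push Not at hx
  have h1 : ∀ᶠ R : ℝ in atTop, sSup (g '' closedBall x₀ R) * R ^ β < g x :=
    h.eventually (gt_mem_nhds hx)
  obtain ⟨R, hR, hR1, hR2⟩ := (h1.and ((eventually_ge_atTop (1:ℝ)).and
    (eventually_ge_atTop (dist x x₀)))).exists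
  have hle : g x ≤ sSup (g '' closedBall x₀ R) :=
    le_csSup ((isCompact_closedBall x₀ R).image hg).bddAbove ⟨x, by simpa using hR2, rfl⟩
  have hp : (1:ℝ) ≤ R ^ β := Real.one_le_rpow hR1 hβ.le
  nlinarith

lemma aux_grad_contDiff {N : ℕ} {g : EuclideanSpace ℝ (Fin N) → ℝ}
    (hg : ContDiff ℝ (⊤ : ℕ∞) g) : ContDiff ℝ (⊤ : ℕ∞) (gradient g) := by
  have h1 : ContDiff ℝ (⊤ : ℕ∞) (fderiv ℝ g) := hg.fderiv_right (by simp)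
  exact (InnerProductSpace.toDual ℝ (EuclideanSpace ℝ (Fin N))).symm.contDiff.comp h1

lemma aux_line {N : ℕ} {g : EuclideanSpace ℝ (Fin N) → ℝ}
    (hg : ContDiff ℝ (⊤ : ℕ∞) g) (x v : EuclideanSpace ℝ (Fin N)) (s : ℝ) :
    HasDerivAt (fun s : ℝ => g (x + s • v)) ⟪gradient g (x + s • v), v⟫ s := by
  have h1 : HasDerivAt (fun s : ℝ => x + s • v) v s := by
    simpa using ((hasDerivAt_id s).smul_const v).const_add x
  have h2 := ((hg.differentiable (by simp)) (x + s • v)).hasGradientAt.hasFDerivAt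
  have h3 := h2.comp_hasDerivAt s h1
  rw [InnerProductSpace.toDual_apply_apply] at h3
  exact h3

lemma aux_line2 {N : ℕ} {g : EuclideanSpace ℝ (Fin N) → ℝ}
    (hg : ContDiff ℝ (⊤ : ℕ∞) g) (x v : EuclideanSpace ℝ (Fin N)) (s : ℝ) :
    HasDerivAt (fun s : ℝ => ⟪gradient g (x + s • v), v⟫) (hess g (x + s • v) v v) s := by
  have h1 : HasDerivAt (fun s : ℝ => x + s • v) v s := by
    simpa using ((hasDerivAt_id s).smul_const v).const_add x
  have h2 := (((aux_grad_contDiff hg).differentiable (by simp)) (x + s • v)).hasFDerivAt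
  have h3 := h2.comp_hasDerivAt s h1
  have h4 := h3.inner ℝ (hasDerivAt_const s v)
  simpa [hess] using h4

/-- Second derivative test (necessary condition). -/
lemma aux_second (φ φ' : ℝ → ℝ) (c : ℝ) (h1 : ∀ s, HasDerivAt φ (φ' s) s)
    (h2 : HasDerivAt φ' c 0) (hmax : ∀ s, φ s ≤ φ 0) : φ' 0 = 0 ∧ c ≤ 0 := by
  have hm : IsLocalMax φ 0 := Eventually.of_forall hmax
  have h0 : φ' 0 = 0 := hm.hasDerivAt_eq_zero (h1 0)
  refine ⟨h0, ?_⟩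
  by_contra hc
  push Not at hc
  have hd : deriv φ = φ' := funext fun s => (h1 s).deriv
  have hmin : IsLocalMin φ 0 := isLocalMin_of_deriv_deriv_pos
    (by rw [hd, h2.deriv]; exact hc) (by rw [hd, h0]) (h1 0).continuousAt
  have he : φ =ᶠ[𝓝 0] fun _ => φ 0 := by
    filter_upwards [hmin] with s hs using le_antisymm (hmax s) hs
  have he2 := he.deriv.deriv_eq
  rw [hd, h2.deriv] at he2
  simp at he2
  exact hc.ne' he2

/-- If `g` is touched from above by a quadratic polynomial. -/
lemma aux_touch {N : ℕ} {g : EuclideanSpace ℝ (Fin N) → ℝ}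
    (hg : ContDiff ℝ (⊤ : ℕ∞) g) (x y : EuclideanSpace ℝ (Fin N)) (a : ℝ)
    (h : ∀ v, g (x + v) ≤ g x + a * ⟪y, v⟫ + a / 2 * ‖v‖ ^ 2) :
    gradient g x = a • y ∧ ∀ v, hess g x v v ≤ a * ‖v‖ ^ 2 := by
  have key : ∀ v, ⟪gradient g x, v⟫ - a * ⟪y, v⟫ = 0 ∧ hess g x v v - a * ‖v‖ ^ 2 ≤ 0 := by
    intro v
    have := aux_second
      (fun s => g (x + s • v) - (a * ⟪y, v⟫ * s + a / 2 * ‖v‖ ^ 2 * s ^ 2))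
      (fun s => ⟪gradient g (x + s • v), v⟫ - (a * ⟪y, v⟫ + a * ‖v‖ ^ 2 * s))
      (hess g x v v - a * ‖v‖ ^ 2) ?_ ?_ ?_
    · simpa using this
    · intro s
      have e := ((hasDerivAt_id s).const_mul (a * ⟪y, v⟫)).add
        ((hasDerivAt_pow 2 s).const_mul (a / 2 * ‖v‖ ^ 2))
      refine ((aux_line hg x v s).sub e).congr_deriv ?_
      simp
      ring
    · have e := ((hasDerivAt_id (0:ℝ)).const_mul (a * ‖v‖ ^ 2)).const_add (a * ⟪y, v⟫)
      refine ((aux_line2 hg x v 0).sub e).congr_deriv ?_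
      simp
    · intro s
      have := h (s • v)
      rw [inner_smul_right, norm_smul, mul_pow] at this
      simp only [Real.norm_eq_abs, sq_abs] at this
      simp
      nlinarith
  refine ⟨?_, fun v => by linarith [(key v).2]⟩
  refine ext_inner_right ℝ fun v => ?_
  rw [inner_smul_left]
  have := (key v).1
  rw [conj_trivial]
  linarith

lemma aux_mono {N : ℕ} {f : EuclideanSpace ℝ (Fin N) → ℝ}
    (hf : ContDiff ℝ (⊤ : ℕ∞) f) (hRic : ∀ x v, (0 : ℝ) ≤ hess f x v v)
    (x₀ x : EuclideanSpace ℝ (Fin N)) :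
    ⟪gradient f x₀, x - x₀⟫ ≤ ⟪gradient f x, x - x₀⟫ := by
  have hm : Monotone (fun s : ℝ => ⟪gradient f (x₀ + s • (x - x₀)), x - x₀⟫) :=
    monotone_of_deriv_nonneg (fun s => (aux_line2 hf x₀ (x - x₀) s).differentiableAt)
      (fun s => by rw [(aux_line2 hf x₀ (x - x₀) s).deriv]; exact hRic _ _)
  simpa using hm zero_le_one

lemma aux_left (φ : ℝ → ℝ) (d t : ℝ) (h : HasDerivAt φ d t) (hmax : ∀ s ≤ t, φ s ≤ φ t) :
    0 ≤ d := by
  by_contra hd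
  push Not at hd
  have h1 : Tendsto (slope φ t) (𝓝[<] t) (𝓝 d) :=
    (hasDerivWithinAt_iff_tendsto_slope' (by simp)).1 h.hasDerivWithinAt
  obtain ⟨s, hs, hst⟩ := ((h1.eventually (gt_mem_nhds hd)).and self_mem_nhdsWithin).exists
  have hst' : s < t := hst
  rw [slope_def_field] at hs
  have : 0 ≤ (φ s - φ t) / (s - t) :=
    div_nonneg_of_nonpos (by linarith [hmax s hst'.le]) (by linarith)
  have e : (φ t - φ s) / (t - s) = (φ s - φ t) / (s - t) := by
    rw [← neg_sub, ← neg_sub s t, neg_div_neg_eq]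
  linarith

lemma aux_sqrt (A B : ℝ) (hA : 0 < A) (hB : 0 ≤ B) :
    √B ≤ √A + (B - A) / (2 * √A) := by
  have h1 : 0 < √A := Real.sqrt_pos.2 hA
  have h2 := Real.sq_sqrt hA.le
  have h3 := Real.sq_sqrt hB
  have : √A + (B - A) / (2 * √A) - √B = (√A - √B) ^ 2 / (2 * √A) := by
    field_simp
    nlinarith
  have : 0 ≤ (√A - √B) ^ 2 / (2 * √A) := by positivity
  linarith

lemma aux_rpow (r β : ℝ) (hr : 0 ≤ r) (h0 : 0 ≤ β) (h1 : β ≤ 1) : r ^ β ≤ 1 + r := by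
  rcases le_total r 1 with h | h
  · linarith [Real.rpow_le_one hr h h0]
  · have := Real.rpow_le_rpow_of_exponent_le h h1
    rw [Real.rpow_one] at this
    linarith

lemma aux_rpow2 (r β : ℝ) (hr : 0 ≤ r) (h0 : 0 ≤ β) (h1 : β ≤ 1) : r ^ β ≤ √(1 + r ^ 2) := by
  rcases le_total r 1 with h | h
  · refine (Real.rpow_le_one hr h h0).trans (Real.one_le_sqrt.2 (by nlinarith))
  · have := Real.rpow_le_rpow_of_exponent_le h h1
    rw [Real.rpow_one] at this
    exact this.trans (Real.le_sqrt_of_sq_le (by linarith))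

/-- **Theorem 1.2(1), Euclidean case.** Under the decay assumptions on `q ≢ 0`, the equation
`∂ₜ u = Δ_f u + q uᵅ` (`α > 1`) has no positive ancient solution with
`u(x,t) = o(|x−x₀|^{1/2} + |t|^{1/4})` near infinity. -/
theorem liouville_no_positive_ancient_solution (N : ℕ)
    (f : EuclideanSpace ℝ (Fin N) → ℝ) (hf : ContDiff ℝ (⊤ : ℕ∞) f)
    (hRic : ∀ x v, (0 : ℝ) ≤ hess f x v v)
    (x₀ : EuclideanSpace ℝ (Fin N))
    (α : ℝ) (hα : 1 < α)
    (q : EuclideanSpace ℝ (Fin N) → ℝ) (hq : ContDiff ℝ (⊤ : ℕ∞) q)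
    (hq0 : ∃ x, q x ≠ 0)
    (hqplus : Filter.Tendsto
      (fun R : ℝ => sSup ((fun x => max (q x) 0) '' closedBall x₀ R) * R ^ (α - 1))
      Filter.atTop (𝓝 0))
    (hqgrad : Filter.Tendsto
      (fun R : ℝ => sSup ((fun x => ‖gradient q x‖) '' closedBall x₀ R) * R ^ (α - 1))
      Filter.atTop (𝓝 0)) :
    ¬ ∃ u : EuclideanSpace ℝ (Fin N) × ℝ → ℝ, ContDiff ℝ (⊤ : ℕ∞) u ∧
        (∀ p : EuclideanSpace ℝ (Fin N) × ℝ, p.2 ≤ 0 → 0 < u p) ∧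
        (∀ p : EuclideanSpace ℝ (Fin N) × ℝ, p.2 ≤ 0 →
          tderiv u p = swlap f u p + q p.1 * u p ^ α) ∧
        Filter.Tendsto
          (fun p : EuclideanSpace ℝ (Fin N) × ℝ =>
            u p / (‖p.1 - x₀‖ ^ ((1 : ℝ) / 2) + |p.2| ^ ((1 : ℝ) / 4)))
          (ancientAtInfty x₀) (𝓝 0) := by
  rintro ⟨u, hu, hpos, heq, hgrow⟩
  -- `q` is a negative constant
  have hqle : ∀ x, q x ≤ 0 := fun x => (le_max_left _ _).trans
    (aux_zero _ (hq.continuous.max continuous_const) x₀ (α - 1) (by linarith) hqplus x)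
  have hqg : ∀ x, gradient q x = 0 := fun x => norm_le_zero_iff.1
    (aux_zero _ (aux_grad_contDiff hq).continuous.norm x₀ (α - 1) (by linarith) hqgrad x)
  have hqconst : ∀ x, q x = q x₀ := fun x => by
    refine is_const_of_fderiv_eq_zero (𝕜 := ℝ) (hq.differentiable (by simp)) (fun z => ?_) x x₀
    have := hqg z
    simpa [gradient] using this
  obtain ⟨c, hc, hqc⟩ : ∃ c : ℝ, 0 < c ∧ ∀ x, q x = -c := by
    obtain ⟨z, hz⟩ := hq0
    refine ⟨-q x₀, ?_, fun x => by rw [hqconst x]; ring⟩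
    have := lt_of_le_of_ne (hqle z) hz
    rw [hqconst z] at this
    linarith
  set u0 := u (x₀, 0) with hu0
  have hu0pos : 0 < u0 := hpos _ le_rfl
  set K := ‖gradient f x₀‖ with hK
  have hK0 : 0 ≤ K := norm_nonneg _
  -- main estimate
  have main : ∀ δ : ℝ, 0 < δ → δ < u0 → c * u0 ^ α ≤ δ * (1 + N + K) := by
    intro δ hδ hδu
    set w : EuclideanSpace ℝ (Fin N) × ℝ → ℝ :=
      fun p => u p - δ * (√(1 + ‖p.1 - x₀‖ ^ 2) - p.2) with hw
    have hwc : Continuous w := by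
      have := hu.continuous
      fun_prop
    obtain ⟨p, hp0, hpmax⟩ : ∃ p : EuclideanSpace ℝ (Fin N) × ℝ, p.2 ≤ 0 ∧
        ∀ p' : EuclideanSpace ℝ (Fin N) × ℝ, p'.2 ≤ 0 → w p' ≤ w p := by
      have hw0 : 0 < w (x₀, 0) := by simp [hw]; linarith
      have h1 := hgrow.eventually (gt_mem_nhds (half_pos hδ))
      rw [ancientAtInfty, eventually_inf_principal, eventually_comap] at h1
      obtain ⟨R, hR1, hR⟩ := ((eventually_ge_atTop (1:ℝ)).and
        (eventually_forall_ge_atTop.2 h1)).exists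
      have hcomp : IsCompact (closedBall x₀ R ×ˢ Icc (-R) (0:ℝ)) :=
        (isCompact_closedBall x₀ R).prod isCompact_Icc
      have hmem : (x₀, (0:ℝ)) ∈ closedBall x₀ R ×ˢ Icc (-R) (0:ℝ) := by
        simp; linarith
      obtain ⟨p, hp, hpm⟩ := hcomp.exists_isMaxOn ⟨_, hmem⟩ hwc.continuousOn
      refine ⟨p, hp.2.2, fun p' hp' => ?_⟩
      by_cases hin : p' ∈ closedBall x₀ R ×ˢ Icc (-R) (0:ℝ)
      · exact hpm hin
      · refine le_trans ?_ (hw0.le.trans (hpm hmem))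
        have habs : |p'.2| = -p'.2 := abs_of_nonpos hp'
        have hn := norm_nonneg (p'.1 - x₀)
        have hbig : R ≤ ‖p'.1 - x₀‖ + |p'.2| := by
          by_contra hlt
          push Not at hlt
          apply hin
          refine ⟨?_, ?_, hp'⟩
          · rw [mem_closedBall, dist_eq_norm]
            linarith [abs_nonneg p'.2]
          · linarith
        have h2 := hR _ hbig p' rfl hp'
        have e1 := aux_rpow2 ‖p'.1 - x₀‖ (1 / 2) hn (by norm_num) (by norm_num)
        have e2 := aux_rpow |p'.2| (1 / 4) (abs_nonneg _) (by norm_num) (by norm_num)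
        have e3 : 1 ≤ √(1 + ‖p'.1 - x₀‖ ^ 2) := Real.one_le_sqrt.2 (by nlinarith)
        have hden : 0 < ‖p'.1 - x₀‖ ^ ((1:ℝ) / 2) + |p'.2| ^ ((1:ℝ) / 4) := by
          rcases hn.eq_or_lt with h | h
          · have : 0 < |p'.2| := by linarith
            positivity
          · positivity
        rw [div_lt_iff₀ hden] at h2
        rw [habs] at h2 e2
        simp only [hw]
        rw [habs] at hbig
        nlinarith
    obtain ⟨x, t⟩ := p
    simp only at hp0
    set S := √(1 + ‖x - x₀‖ ^ 2) with hS
    have hS1 : 1 ≤ S := Real.one_le_sqrt.2 (by nlinarith [norm_nonneg (x - x₀)])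
    have hSr : ‖x - x₀‖ ≤ S := Real.le_sqrt_of_sq_le (by linarith)
    have hS0 : 0 < S := by linarith
    have hux : u0 ≤ u (x, t) := by
      have := hpmax (x₀, 0) le_rfl
      simp [hw] at this
      rw [← hS] at this
      nlinarith
    have hus : ContDiff ℝ (⊤ : ℕ∞) (fun y => u (y, t)) :=
      hu.comp (contDiff_id.prodMk contDiff_const)
    have hut : ContDiff ℝ (⊤ : ℕ∞) (fun s => u (x, s)) :=
      hu.comp (contDiff_const.prodMk contDiff_id)
    obtain ⟨hgr, hhs⟩ := aux_touch hus x (x - x₀) (δ / S) (fun v => by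
      have h1 := hpmax (x + v, t) hp0
      simp only [hw] at h1
      rw [← hS] at h1
      have h2 := aux_sqrt (1 + ‖x - x₀‖ ^ 2) (1 + ‖x + v - x₀‖ ^ 2) (by positivity)
        (by positivity)
      rw [← hS] at h2
      have h3 : ‖x + v - x₀‖ ^ 2 = ‖x - x₀‖ ^ 2 + 2 * ⟪x - x₀, v⟫ + ‖v‖ ^ 2 := by
        rw [← norm_add_sq_real]; congr 2; abel
      rw [h3] at h2 h1
      have h4 := mul_le_mul_of_nonneg_left h2 hδ.le
      have h5 : δ * (S + (1 + (‖x - x₀‖ ^ 2 + 2 * ⟪x - x₀, v⟫ + ‖v‖ ^ 2)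
          - (1 + ‖x - x₀‖ ^ 2)) / (2 * S)) =
          δ * S + δ / S * ⟪x - x₀, v⟫ + δ / S / 2 * ‖v‖ ^ 2 := by
        field_simp
        ring
      linarith)
    have hdS : δ / S ≤ δ := div_le_self hδ.le hS1
    have hdS0 : 0 < δ / S := div_pos hδ hS0
    have hlap : lap (fun y => u (y, t)) x ≤ δ * N := by
      unfold lap
      calc _ ≤ ∑ _i : Fin N, δ := Finset.sum_le_sum (fun i _ => by
            have := hhs (EuclideanSpace.single i 1)
            simp at this
            linarith)
        _ = δ * N := by simp [mul_comm]
    have hdrift : -⟪gradient f x, gradient (fun y => u (y, t)) x⟫ ≤ δ * K := by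
      rw [hgr, inner_smul_right]
      have h1 := aux_mono hf hRic x₀ x
      have h2 : -(K * ‖x - x₀‖) ≤ ⟪gradient f x₀, x - x₀⟫ :=
        neg_le_of_abs_le (abs_real_inner_le_norm _ _)
      have h3 : -⟪gradient f x, x - x₀⟫ ≤ K * S := by nlinarith
      calc -(δ / S * ⟪gradient f x, x - x₀⟫) = δ / S * (-⟪gradient f x, x - x₀⟫) := by ring
        _ ≤ δ / S * (K * S) := mul_le_mul_of_nonneg_left h3 hdS0.le
        _ = δ * K := by field_simp
    have htime : -δ ≤ tderiv u (x, t) := by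
      have h1 : HasDerivAt (fun s => u (x, s)) (tderiv u (x, t)) t :=
        ((hut.differentiable (by simp)) t).hasDerivAt
      have h2 := aux_left (fun s => u (x, s) + δ * s) _ t
        (h1.add ((hasDerivAt_id t).const_mul δ)) (fun s hs => by
          have := hpmax (x, s) (hs.trans hp0)
          simp only [hw] at this
          linarith)
      linarith
    have hE := heq (x, t) hp0
    simp only [swlap, wlap, hqc] at hE
    have hpow : u0 ^ α ≤ u (x, t) ^ α := Real.rpow_le_rpow hu0pos.le hux (by linarith)
    nlinarith
  have hL : 0 < c * u0 ^ α := by positivity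
  have hD : (0:ℝ) < 1 + N + K := by positivity
  have hm := main (min (u0 / 2) (c * u0 ^ α / (2 * (1 + N + K)))) (by positivity)
    ((min_le_left _ _).trans_lt (by linarith))
  have h2 := mul_le_mul_of_nonneg_right (min_le_right (u0 / 2) (c * u0 ^ α / (2 * (1 + N + K))))
    hD.le
  have h3 : c * u0 ^ α / (2 * (1 + N + K)) * (1 + N + K) = c * u0 ^ α / 2 := by
    field_simp
  linarith
end
end

section
/- Let f : ℝ^N → ℝ be smooth with ∇²f(v,v) ≥ 0 for all vectors v, and fix x₀ ∈ ℝ^N. Then every smooth positive ancient solution u of the weighted heat equation ∂ₜu = Δ_f u on ℝ^N × (−∞, 0] satisfying u(x,t) = o(|x−x₀|^{1/2} + |t|^{1/4}) near infinity is constant. -/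
open Real Set Metric Filter
open scoped RealInnerProductSpace Topology

noncomputable section

/-- Directional derivative. -/
def DD {V : Type*} [NormedAddCommGroup V] [NormedSpace ℝ V] (v : V) (g : V → ℝ) : V → ℝ :=
  fun p => fderiv ℝ g p v

section DDlemmas
variable {V : Type*} [NormedAddCommGroup V] [NormedSpace ℝ V]

lemma DD_smooth {g : V → ℝ} (hg : ContDiff ℝ (⊤ : ℕ∞) g) (v : V) :
    ContDiff ℝ (⊤ : ℕ∞) (DD v g) := by
  have h : ContDiff ℝ (⊤ : ℕ∞) (fderiv ℝ g) := hg.fderiv_right (by simp)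
  exact h.clm_apply contDiff_const

lemma sm_diff {g : V → ℝ} (hg : ContDiff ℝ (⊤ : ℕ∞) g) (p : V) : DifferentiableAt ℝ g p :=
  (hg.differentiable (by simp)) p

lemma DD_add {g h : V → ℝ} (hg : ContDiff ℝ (⊤ : ℕ∞) g) (hh : ContDiff ℝ (⊤ : ℕ∞) h) (v : V) :
    DD v (fun p => g p + h p) = fun p => DD v g p + DD v h p := by
  funext p
  simp only [DD]
  rw [fderiv_fun_add (sm_diff hg p) (sm_diff hh p)]; rfl

lemma DD_sub {g h : V → ℝ} (hg : ContDiff ℝ (⊤ : ℕ∞) g) (hh : ContDiff ℝ (⊤ : ℕ∞) h) (v : V) :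
    DD v (fun p => g p - h p) = fun p => DD v g p - DD v h p := by
  funext p
  simp only [DD]
  rw [fderiv_fun_sub (sm_diff hg p) (sm_diff hh p)]; rfl

lemma DD_mul {g h : V → ℝ} (hg : ContDiff ℝ (⊤ : ℕ∞) g) (hh : ContDiff ℝ (⊤ : ℕ∞) h) (v : V) :
    DD v (fun p => g p * h p) = fun p => g p * DD v h p + h p * DD v g p := by
  funext p
  simp only [DD]
  rw [fderiv_fun_mul (sm_diff hg p) (sm_diff hh p)]; rfl

lemma DD_const (c : ℝ) (v : V) : DD v (fun _ : V => c) = fun _ => 0 := by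
  funext p
  simp [DD]

lemma DD_sum {ι : Type*} (s : Finset ι) {g : ι → V → ℝ}
    (hg : ∀ i, ContDiff ℝ (⊤ : ℕ∞) (g i)) (v : V) :
    DD v (fun p => ∑ i ∈ s, g i p) = fun p => ∑ i ∈ s, DD v (g i) p := by
  funext p
  simp only [DD]
  rw [fderiv_fun_sum (fun i _ => sm_diff (hg i) p)]
  simp

lemma DD_comm {g : V → ℝ} (hg : ContDiff ℝ (⊤ : ℕ∞) g) (v w : V) :
    DD v (DD w g) = DD w (DD v g) := by
  funext p
  have hs : IsSymmSndFDerivAt ℝ g p :=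
    (hg.contDiffAt).isSymmSndFDerivAt (by
      simp only [minSmoothness_of_isRCLikeNormedField]
      exact WithTop.coe_le_coe.2 (le_top (a := (2 : ℕ∞))))
  have hd : DifferentiableAt ℝ (fderiv ℝ g) p :=
    ((hg.fderiv_right (m := (⊤ : ℕ∞)) (by simp)).differentiable (by simp)) p
  have key : ∀ a b : V, DD a (DD b g) p = fderiv ℝ (fderiv ℝ g) p a b := by
    intro a b
    have : HasFDerivAt (DD b g) ((fderiv ℝ (fderiv ℝ g) p).flip b) p := by
      have := hd.hasFDerivAt.clm_apply (hasFDerivAt_const b p)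
      have e : (fderiv ℝ g p).comp (0 : V →L[ℝ] V) + (fderiv ℝ (fderiv ℝ g) p).flip b
          = (fderiv ℝ (fderiv ℝ g) p).flip b := by simp
      exact e ▸ this
    change fderiv ℝ (DD b g) p a = _
    rw [this.fderiv]; rfl
  rw [key, key]
  exact hs v w

/-- derivative along a line -/
lemma DD_line {g : V → ℝ} (hg : ContDiff ℝ (⊤ : ℕ∞) g) (v p : V) (s : ℝ) :
    HasDerivAt (fun s : ℝ => g (p + s • v)) (DD v g (p + s • v)) s := by
  have h1 : HasDerivAt (fun s : ℝ => p + s • v) v s := by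
    simpa using ((hasDerivAt_id s).smul_const v).const_add p
  exact (sm_diff hg _).hasFDerivAt.comp_hasDerivAt s h1

lemma DD_zero_of_line {g : V → ℝ} (hg : ContDiff ℝ (⊤ : ℕ∞) g) (v p : V)
    (h : ∀ s : ℝ, g (p + s • v) = 0) : DD v g p = 0 := by
  have h1 := DD_line hg v p 0
  have h2 : (fun s : ℝ => g (p + s • v)) = fun _ => 0 := funext h
  rw [h2] at h1
  simpa using h1.unique (hasDerivAt_const 0 0)

/-- necessary second order condition. -/
lemma DD_second {g : V → ℝ} (hg : ContDiff ℝ (⊤ : ℕ∞) g) (v p : V)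
    (h : ∀ᶠ s : ℝ in 𝓝 0, g (p + s • v) ≤ g p) : DD v (DD v g) p ≤ 0 := by
  by_contra! hpos
  set φ : ℝ → ℝ := fun s => g (p + s • v) with hφ
  have hd : deriv φ = fun s => DD v g (p + s • v) := by
    funext s; exact (DD_line hg v p s).deriv
  have hd2 : deriv (deriv φ) = fun s => DD v (DD v g) (p + s • v) := by
    rw [hd]; funext s; exact (DD_line (DD_smooth hg v) v p s).deriv
  have hmax : IsLocalMax φ 0 := by
    filter_upwards [h] with s hs
    simpa [hφ] using hs
  have hmin : IsLocalMin φ 0 := by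
    apply isLocalMin_of_deriv_deriv_pos
    · rw [hd2]; simpa using hpos
    · exact hmax.deriv_eq_zero
    · exact (DD_line hg v p 0).continuousAt
  have hc : φ =ᶠ[𝓝 0] fun _ => φ 0 := by
    filter_upwards [hmax, hmin] with s h1 h2
    exact le_antisymm h1 h2
  have hc1 : deriv φ =ᶠ[𝓝 0] fun _ => 0 := by
    simpa using hc.deriv
  have := hc1.deriv_eq
  rw [hd2] at this
  simp at this
  linarith

lemma DD_left {g : V → ℝ} (hg : ContDiff ℝ (⊤ : ℕ∞) g) (v p : V)
    (h : ∀ᶠ s : ℝ in 𝓝[<] 0, g (p + s • v) ≤ g p) : 0 ≤ DD v g p := by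
  have h1 := (DD_line hg v p 0)
  simp only [zero_smul, add_zero] at h1
  have h2 := (hasDerivAt_iff_tendsto_slope.1 h1).mono_left
    (nhdsWithin_mono 0 (show Iio (0:ℝ) ⊆ {0}ᶜ from fun x hx => ne_of_lt hx))
  refine ge_of_tendsto h2 ?_
  filter_upwards [h, self_mem_nhdsWithin] with s hs hs0
  have hs0 : s < 0 := hs0
  rw [slope_def_field]
  simp only [zero_smul, add_zero, sub_zero]
  exact div_nonneg_of_nonpos (by linarith) hs0.le

lemma DD_first {g : V → ℝ} (hg : ContDiff ℝ (⊤ : ℕ∞) g) (v p : V)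
    (h : ∀ᶠ s : ℝ in 𝓝 0, g (p + s • v) ≤ g p) : DD v g p = 0 := by
  have h1 := (DD_line hg v p 0)
  simp only [zero_smul, add_zero] at h1
  refine IsLocalMax.hasDerivAt_eq_zero (f := fun s : ℝ => g (p + s • v)) (a := 0) ?_ h1
  filter_upwards [h] with s hs
  simpa using hs

end DDlemmas

section Heat
variable {N : ℕ}

/-- spatial basis vectors in space-time -/
def ee (i : Fin N) : EuclideanSpace ℝ (Fin N) × ℝ := (EuclideanSpace.single i 1, 0)

/-- time vector -/
def tt : EuclideanSpace ℝ (Fin N) × ℝ := (0, 1)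

/-- heat operator with drift coefficients given by the space-time function `f` -/
def LL (f g : EuclideanSpace ℝ (Fin N) × ℝ → ℝ) : EuclideanSpace ℝ (Fin N) × ℝ → ℝ :=
  fun p => DD tt g p - ∑ i, (DD (ee i) (DD (ee i) g) p - DD (ee i) f p * DD (ee i) g p)

variable {f g h u : EuclideanSpace ℝ (Fin N) × ℝ → ℝ}

lemma LL_smooth (hf : ContDiff ℝ (⊤ : ℕ∞) f) (hg : ContDiff ℝ (⊤ : ℕ∞) g) :
    ContDiff ℝ (⊤ : ℕ∞) (LL f g) := by
  unfold LL
  refine (DD_smooth hg _).sub (ContDiff.sum fun i _ => ?_)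
  exact (DD_smooth (DD_smooth hg _) _).sub ((DD_smooth hf _).mul (DD_smooth hg _))

lemma LL_mul (hg : ContDiff ℝ (⊤ : ℕ∞) g) (hh : ContDiff ℝ (⊤ : ℕ∞) h) 
    (p : EuclideanSpace ℝ (Fin N) × ℝ) :
    LL f (fun p => g p * h p) p =
      g p * LL f h p + h p * LL f g p - 2 * ∑ i, DD (ee i) g p * DD (ee i) h p := by
  have h2 : ∀ i, DD (ee i) (DD (ee i) (fun p => g p * h p)) p
      = g p * DD (ee i) (DD (ee i) h) p + h p * DD (ee i) (DD (ee i) g) p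
        + 2 * (DD (ee i) g p * DD (ee i) h p) := by
    intro i
    rw [DD_mul hg hh, DD_add (hg.mul (DD_smooth hh _)) (hh.mul (DD_smooth hg _)),
      DD_mul hg (DD_smooth hh _), DD_mul hh (DD_smooth hg _)]
    ring
  unfold LL
  simp only [h2]
  simp only [DD_mul hg hh]
  have key : ∑ i, (g p * DD (ee i) (DD (ee i) h) p + h p * DD (ee i) (DD (ee i) g) p
        + 2 * (DD (ee i) g p * DD (ee i) h p)
        - DD (ee i) f p * (g p * DD (ee i) h p + h p * DD (ee i) g p))
      = g p * ∑ i, (DD (ee i) (DD (ee i) h) p - DD (ee i) f p * DD (ee i) h p)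
        + h p * ∑ i, (DD (ee i) (DD (ee i) g) p - DD (ee i) f p * DD (ee i) g p)
        + 2 * ∑ i, DD (ee i) g p * DD (ee i) h p := by
    simp only [Finset.mul_sum, ← Finset.sum_add_distrib]
    refine Finset.sum_congr rfl fun i _ => ?_
    ring
  rw [key]; ring

lemma LL_add (hg : ContDiff ℝ (⊤ : ℕ∞) g) (hh : ContDiff ℝ (⊤ : ℕ∞) h)
    (p : EuclideanSpace ℝ (Fin N) × ℝ) :
    LL f (fun p => g p + h p) p = LL f g p + LL f h p := by
  unfold LL
  simp only [DD_add hg hh, DD_add (DD_smooth hg _) (DD_smooth hh _), mul_add]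
  have : ∀ a b c d : ℝ, (a + b - (c + d)) = (a - c) + (b - d) := by intros; ring
  simp only [this, Finset.sum_add_distrib]

lemma LL_const (c : ℝ) (p : EuclideanSpace ℝ (Fin N) × ℝ) :
    LL f (fun _ => c) p = 0 := by
  simp [LL, DD_const]

lemma LL_sum {ι : Type*} (s : Finset ι) {g : ι → EuclideanSpace ℝ (Fin N) × ℝ → ℝ}
    (hg : ∀ i, ContDiff ℝ (⊤ : ℕ∞) (g i)) (p : EuclideanSpace ℝ (Fin N) × ℝ) :
    LL f (fun p => ∑ i ∈ s, g i p) p = ∑ i ∈ s, LL f (g i) p := by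
  classical
  induction s using Finset.induction_on with
  | empty => simp [LL_const]
  | insert a s ha ih =>
    simp only [Finset.sum_insert ha]
    rw [LL_add (hg a) (ContDiff.sum fun i _ => hg i), ih]

lemma LL_DD (hf : ContDiff ℝ (⊤ : ℕ∞) f) (hu : ContDiff ℝ (⊤ : ℕ∞) u) (j : Fin N)
    (p : EuclideanSpace ℝ (Fin N) × ℝ) :
    LL f (DD (ee j) u) p = DD (ee j) (LL f u) p
      - ∑ i, DD (ee j) (DD (ee i) f) p * DD (ee i) u p := by
  have e : LL f u = fun p => DD tt u p -
    ∑ i, (DD (ee i) (DD (ee i) u) p - DD (ee i) f p * DD (ee i) u p) := rfl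
  have s1 : ∀ i : Fin N, ContDiff ℝ (⊤ : ℕ∞) (fun p => DD (ee i) f p * DD (ee i) u p) :=
    fun i => (DD_smooth hf _).mul (DD_smooth hu _)
  have s2 : ∀ i : Fin N, ContDiff ℝ (⊤ : ℕ∞) (DD (ee i) (DD (ee i) u)) :=
    fun i => (DD_smooth (DD_smooth hu _) _)
  have s3 : ∀ i : Fin N, ContDiff ℝ (⊤ : ℕ∞)
      (fun p => DD (ee i) (DD (ee i) u) p - DD (ee i) f p * DD (ee i) u p) :=
    fun i => (s2 i).sub (s1 i)
  rw [e, DD_sub (DD_smooth hu _) (ContDiff.sum fun i _ => s3 i), DD_sum _ s3]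
  simp only [DD_sub (s2 _) (s1 _), DD_mul (DD_smooth hf _) (DD_smooth hu _)]
  unfold LL
  rw [DD_comm hu tt (ee j)]
  have : ∀ i : Fin N, DD (ee i) (DD (ee i) (DD (ee j) u)) = DD (ee j) (DD (ee i) (DD (ee i) u)) := by
    intro i
    rw [DD_comm hu (ee i) (ee j), DD_comm (DD_smooth hu _) (ee i) (ee j)]
  simp only [this]
  rw [sub_sub, ← Finset.sum_add_distrib]
  congr 1
  refine Finset.sum_congr rfl fun i _ => ?_
  rw [DD_comm hu (ee i) (ee j)]
  ring

/-- squared spatial gradient -/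
def ww (u : EuclideanSpace ℝ (Fin N) × ℝ → ℝ) : EuclideanSpace ℝ (Fin N) × ℝ → ℝ :=
  fun p => ∑ j, DD (ee j) u p * DD (ee j) u p

lemma ww_smooth (hu : ContDiff ℝ (⊤ : ℕ∞) u) : ContDiff ℝ (⊤ : ℕ∞) (ww u) :=
  ContDiff.sum fun _ _ => (DD_smooth hu _).mul (DD_smooth hu _)

lemma ww_nonneg (p : EuclideanSpace ℝ (Fin N) × ℝ) : 0 ≤ ww u p :=
  Finset.sum_nonneg fun _ _ => mul_self_nonneg _

lemma bochner (hf : ContDiff ℝ (⊤ : ℕ∞) f) (hu : ContDiff ℝ (⊤ : ℕ∞) u)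
    (p : EuclideanSpace ℝ (Fin N) × ℝ)
    (hconv : ∀ a : Fin N → ℝ, 0 ≤ ∑ j, ∑ i, a j * (DD (ee j) (DD (ee i) f) p * a i))
    (heq : ∀ j, DD (ee j) (LL f u) p = 0) :
    LL f (ww u) p ≤ - 2 * ∑ j, ∑ i, DD (ee i) (DD (ee j) u) p * DD (ee i) (DD (ee j) u) p := by
  unfold ww
  rw [LL_sum _ (fun j => (DD_smooth hu _).mul (DD_smooth hu _))]
  simp only [LL_mul (DD_smooth hu _) (DD_smooth hu _), LL_DD hf hu, heq]
  have := hconv (fun j => DD (ee j) u p)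
  simp only [← Finset.mul_sum] at this
  have e : ∀ a b c : ℝ, a * (0 - b) + a * (0 - b) - 2 * c = -2 * (a * b) + -2 * c := by
    intros; ring
  simp only [e, Finset.sum_add_distrib, ← Finset.mul_sum]
  linarith

lemma main_ineq {G : EuclideanSpace ℝ (Fin N) × ℝ → ℝ}
    (hf : ContDiff ℝ (⊤ : ℕ∞) f) (hu : ContDiff ℝ (⊤ : ℕ∞) u)
    (hG : ContDiff ℝ (⊤ : ℕ∞) G)
    (p : EuclideanSpace ℝ (Fin N) × ℝ)
    (hconv : ∀ a : Fin N → ℝ, 0 ≤ ∑ j, ∑ i, a j * (DD (ee j) (DD (ee i) f) p * a i))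
    (heq0 : LL f u p = 0)
    (heq : ∀ j, DD (ee j) (LL f u) p = 0) (B : ℝ) :
    LL f (fun p => (G p * G p) * ww u p + B * (u p * u p)) p
      ≤ ww u p * (2 * G p * LL f G p + 6 * (∑ i, DD (ee i) G p * DD (ee i) G p) - 2 * B) := by
  have hw := ww_smooth hu
  have hb := bochner hf hu p hconv heq
  have hB : ContDiff ℝ (⊤ : ℕ∞) (fun _ : EuclideanSpace ℝ (Fin N) × ℝ => B) := contDiff_const
  rw [LL_add ((hG.mul hG).mul hw) (hB.mul (hu.mul hu)), LL_mul (hG.mul hG) hw,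
    LL_mul hG hG, LL_mul hB (hu.mul hu), LL_mul hu hu, LL_const, heq0]
  simp only [DD_const, DD_mul hG hG]
  have hdw : ∀ i : Fin N, DD (ee i) (ww u) p
      = ∑ j, 2 * (DD (ee j) u p * DD (ee i) (DD (ee j) u) p) := by
    intro i
    unfold ww
    rw [DD_sum _ (fun j => (DD_smooth hu _).mul (DD_smooth hu _))]
    refine Finset.sum_congr rfl fun j _ => ?_
    rw [DD_mul (DD_smooth hu _) (DD_smooth hu _)]
    ring
  have hww : ∑ j, DD (ee j) u p * DD (ee j) u p = ww u p := rfl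
  rw [hww]
  have hcross : -2 * ∑ i, (G p * DD (ee i) G p + G p * DD (ee i) G p) * DD (ee i) (ww u) p
      ≤ 2 * (G p * G p) * ∑ j, ∑ i, DD (ee i) (DD (ee j) u) p * DD (ee i) (DD (ee j) u) p
        + 8 * (ww u p * ∑ i, DD (ee i) G p * DD (ee i) G p) := by
    rw [← hww, Finset.sum_mul_sum]
    simp only [hdw, Finset.mul_sum]
    rw [Finset.sum_comm, ← Finset.sum_add_distrib]
    refine Finset.sum_le_sum fun j _ => ?_
    rw [← Finset.sum_add_distrib]
    refine Finset.sum_le_sum fun i _ => ?_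
    nlinarith [sq_nonneg (G p * DD (ee i) (DD (ee j) u) p + 2 * (DD (ee i) G p * DD (ee j) u p))]
  have h1 : (G p * G p) * LL f (ww u) p ≤ (G p * G p) *
      (- 2 * ∑ j, ∑ i, DD (ee i) (DD (ee j) u) p * DD (ee i) (DD (ee j) u) p) :=
    mul_le_mul_of_nonneg_left hb (mul_self_nonneg _)
  simp only [zero_mul, Finset.sum_const_zero]
  nlinarith [hcross, h1]

end Heat

section Bridge
variable {N : ℕ}

lemma inner_grad (g : EuclideanSpace ℝ (Fin N) → ℝ) (x v : EuclideanSpace ℝ (Fin N)) :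
    ⟪gradient g x, v⟫ = DD v g x := by
  simp [gradient, DD, InnerProductSpace.toDual_symm_apply]

lemma grad_diff {g : EuclideanSpace ℝ (Fin N) → ℝ} (hg : ContDiff ℝ (⊤ : ℕ∞) g)
    (x : EuclideanSpace ℝ (Fin N)) : DifferentiableAt ℝ (gradient g) x := by
  have hd : DifferentiableAt ℝ (fderiv ℝ g) x :=
    ((hg.fderiv_right (m := (⊤ : ℕ∞)) (by simp)).differentiable (by simp)) x
  exact (InnerProductSpace.toDual ℝ (EuclideanSpace ℝ (Fin N))).symm.toContinuousLinearEquiv.differentiableAt.comp x hd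

lemma hess_eq {g : EuclideanSpace ℝ (Fin N) → ℝ} (hg : ContDiff ℝ (⊤ : ℕ∞) g)
    (x v w : EuclideanSpace ℝ (Fin N)) : hess g x v w = DD v (DD w g) x := by
  have h : DD w g = fun y => ⟪gradient g y, w⟫ := by
    funext y; exact (inner_grad g y w).symm
  rw [h]
  unfold hess DD
  rw [fderiv_inner_apply ℝ (grad_diff hg x) (differentiableAt_const w)]
  simp

lemma slice {h : EuclideanSpace ℝ (Fin N) × ℝ → ℝ} (hh : ContDiff ℝ (⊤ : ℕ∞) h)
    (w : EuclideanSpace ℝ (Fin N)) (t : ℝ) :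
    DD w (fun y => h (y, t)) = fun y => DD (w, (0 : ℝ)) h (y, t) := by
  funext x
  have h1 : HasFDerivAt (fun y : EuclideanSpace ℝ (Fin N) => (y, t))
    (ContinuousLinearMap.inl ℝ (EuclideanSpace ℝ (Fin N)) ℝ) x := hasFDerivAt_prodMk_left x t
  have h2 := (sm_diff hh (x, t)).hasFDerivAt.comp x h1
  change fderiv ℝ (h ∘ fun y => (y, t)) x w = _
  rw [h2.fderiv]
  simp [DD]

lemma slice_smooth {h : EuclideanSpace ℝ (Fin N) × ℝ → ℝ} (hh : ContDiff ℝ (⊤ : ℕ∞) h) (t : ℝ) :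
    ContDiff ℝ (⊤ : ℕ∞) (fun y => h (y, t)) :=
  hh.comp (contDiff_id.prodMk contDiff_const)

lemma lift_DD {g : EuclideanSpace ℝ (Fin N) → ℝ} (hg : ContDiff ℝ (⊤ : ℕ∞) g)
    (v : EuclideanSpace ℝ (Fin N) × ℝ) :
    DD v (fun p : EuclideanSpace ℝ (Fin N) × ℝ => g p.1) = fun p => DD v.1 g p.1 := by
  funext p
  have h2 := (sm_diff hg p.1).hasFDerivAt.comp p hasFDerivAt_fst
  change fderiv ℝ (g ∘ Prod.fst) p v = _
  rw [h2.fderiv]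
  simp [DD]

lemma lift_smooth {g : EuclideanSpace ℝ (Fin N) → ℝ} (hg : ContDiff ℝ (⊤ : ℕ∞) g) :
    ContDiff ℝ (⊤ : ℕ∞) (fun p : EuclideanSpace ℝ (Fin N) × ℝ => g p.1) :=
  hg.comp contDiff_fst

lemma tderiv_eq {u : EuclideanSpace ℝ (Fin N) × ℝ → ℝ} (hu : ContDiff ℝ (⊤ : ℕ∞) u)
    (p : EuclideanSpace ℝ (Fin N) × ℝ) : tderiv u p = DD tt u p := by
  have h1 : HasFDerivAt (fun s : ℝ => (p.1, s))
    (ContinuousLinearMap.inr ℝ (EuclideanSpace ℝ (Fin N)) ℝ) p.2 := hasFDerivAt_prodMk_right p.1 p.2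
  have h2 := (sm_diff hu (p.1, p.2)).hasFDerivAt.comp p.2 h1
  have h3 := h2.hasDerivAt.deriv
  unfold tderiv
  change deriv (u ∘ fun s => (p.1, s)) p.2 = _
  rw [h3]
  simp [DD, tt]

lemma LL_eq {f : EuclideanSpace ℝ (Fin N) → ℝ} (hf : ContDiff ℝ (⊤ : ℕ∞) f)
    {u : EuclideanSpace ℝ (Fin N) × ℝ → ℝ} (hu : ContDiff ℝ (⊤ : ℕ∞) u)
    (p : EuclideanSpace ℝ (Fin N) × ℝ) :
    LL (fun p => f p.1) u p = tderiv u p - swlap f u p := by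
  unfold LL swlap wlap lap
  rw [tderiv_eq hu, Finset.sum_sub_distrib]
  have h1 : ⟪gradient f p.1, gradient (fun y => u (y, p.2)) p.1⟫
      = ∑ i, DD (ee i) (fun p => f p.1) p * DD (ee i) u p := by
    have key : ∀ (g : EuclideanSpace ℝ (Fin N) → ℝ) x i, (gradient g x) i
        = DD (EuclideanSpace.single i 1) g x := by
      intro g x i
      rw [← inner_grad, EuclideanSpace.inner_single_right]; simp
    rw [PiLp.inner_apply]
    refine Finset.sum_congr rfl fun i _ => ?_
    rw [key, key, lift_DD hf, slice hu]
    simp [ee, mul_comm]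
  rw [h1]
  congr 2
  refine Finset.sum_congr rfl fun i _ => ?_
  rw [hess_eq (slice_smooth hu _), slice hu, slice (DD_smooth hu _)]
  rfl

lemma conv_eq {f : EuclideanSpace ℝ (Fin N) → ℝ} (hf : ContDiff ℝ (⊤ : ℕ∞) f)
    (hRic : ∀ x v, (0 : ℝ) ≤ hess f x v v) (p : EuclideanSpace ℝ (Fin N) × ℝ) (a : Fin N → ℝ) :
    0 ≤ ∑ j, ∑ i, a j * (DD (ee j) (DD (ee i) (fun p => f p.1)) p * a i) := by
  have h := hRic p.1 (∑ i, a i • EuclideanSpace.single i 1)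
  unfold hess at h
  simp only [map_sum, map_smul, sum_inner, inner_sum, real_inner_smul_left,
    real_inner_smul_right] at h
  refine h.trans_eq (Finset.sum_congr rfl fun j _ => Finset.sum_congr rfl fun i _ => ?_)
  rw [lift_DD hf, lift_DD (DD_smooth hf _)]
  have := hess_eq hf p.1 (EuclideanSpace.single i 1) (EuclideanSpace.single j 1)
  unfold hess at this
  rw [this, DD_comm hf]
  simp only [ee]
  ring

lemma grad_mono {f : EuclideanSpace ℝ (Fin N) → ℝ} (hf : ContDiff ℝ (⊤ : ℕ∞) f)
    (hRic : ∀ x v, (0 : ℝ) ≤ hess f x v v) (x₀ x : EuclideanSpace ℝ (Fin N)) :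
    DD (x - x₀) f x₀ ≤ DD (x - x₀) f x := by
  have hm : Monotone (fun s : ℝ => DD (x - x₀) f (x₀ + s • (x - x₀))) := by
    apply monotone_of_hasDerivAt_nonneg (f' := fun s => DD (x - x₀) (DD (x - x₀) f) (x₀ + s • (x - x₀)))
    · intro s; exact DD_line (DD_smooth hf _) _ _ s
    · intro s
      have := hRic (x₀ + s • (x - x₀)) (x - x₀)
      rwa [hess_eq hf] at this
  have := hm (zero_le_one)
  simpa using this

/-- cutoff -/
def GG (x₀ : EuclideanSpace ℝ (Fin N)) (R : ℝ) : EuclideanSpace ℝ (Fin N) × ℝ → ℝ :=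
  fun p => R ^ 2 - ‖p.1 - x₀‖ ^ 2 + p.2

lemma GG_smooth (x₀ : EuclideanSpace ℝ (Fin N)) (R : ℝ) : ContDiff ℝ (⊤ : ℕ∞) (GG x₀ R) := by
  unfold GG
  exact (contDiff_const.sub ((contDiff_fst.sub contDiff_const).norm_sq ℝ)).add contDiff_snd

lemma GG_DD (x₀ : EuclideanSpace ℝ (Fin N)) (R : ℝ) (v : EuclideanSpace ℝ (Fin N) × ℝ) :
    DD v (GG x₀ R) = fun p => - 2 * ⟪p.1 - x₀, v.1⟫ + v.2 := by
  funext p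
  have h1 : HasFDerivAt (fun p : EuclideanSpace ℝ (Fin N) × ℝ => p.1 - x₀)
    (ContinuousLinearMap.fst ℝ (EuclideanSpace ℝ (Fin N)) ℝ) p := hasFDerivAt_fst.sub_const x₀
  have h2 := (h1.norm_sq.const_sub (R ^ 2)).add (hasFDerivAt_snd (𝕜 := ℝ) (p := p))
  have h3 : HasFDerivAt (GG x₀ R) _ p := h2
  unfold DD
  rw [h3.fderiv]
  simp [inner_sub_left]

lemma GG_DD2 (x₀ : EuclideanSpace ℝ (Fin N)) (R : ℝ) (i : Fin N)
    (p : EuclideanSpace ℝ (Fin N) × ℝ) :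
    DD (ee i) (DD (ee i) (GG x₀ R)) p = - 2 := by
  rw [GG_DD]
  have h1 : HasFDerivAt (fun p : EuclideanSpace ℝ (Fin N) × ℝ => p.1 - x₀)
    (ContinuousLinearMap.fst ℝ (EuclideanSpace ℝ (Fin N)) ℝ) p := hasFDerivAt_fst.sub_const x₀
  have h2 := (((h1.inner ℝ (hasFDerivAt_const (ee i).1 p)).const_mul (-2)).add_const (ee i).2)
  unfold DD
  rw [h2.fderiv]
  simp [ee]

lemma GG_grad (x₀ : EuclideanSpace ℝ (Fin N)) (R : ℝ) (p : EuclideanSpace ℝ (Fin N) × ℝ) :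
    ∑ i, DD (ee i) (GG x₀ R) p * DD (ee i) (GG x₀ R) p = 4 * ‖p.1 - x₀‖ ^ 2 := by
  rw [EuclideanSpace.norm_sq_eq, Finset.mul_sum]
  refine Finset.sum_congr rfl fun i _ => ?_
  rw [GG_DD]
  simp only [ee, EuclideanSpace.inner_single_right]
  simp
  ring

lemma GG_LL {f : EuclideanSpace ℝ (Fin N) → ℝ} (hf : ContDiff ℝ (⊤ : ℕ∞) f)
    (x₀ : EuclideanSpace ℝ (Fin N)) (R : ℝ) (p : EuclideanSpace ℝ (Fin N) × ℝ) :
    LL (fun p => f p.1) (GG x₀ R) p = 1 + 2 * N - 2 * DD (p.1 - x₀) f p.1 := by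
  unfold LL
  have h : DD (p.1 - x₀) f p.1 = ∑ i, DD (ee i) (fun p => f p.1) p * ⟪p.1 - x₀, (ee i).1⟫ := by
    rw [← inner_grad, PiLp.inner_apply]
    refine Finset.sum_congr rfl fun i _ => ?_
    rw [lift_DD hf]
    simp only [ee, EuclideanSpace.inner_single_right, ← inner_grad]
    simp [mul_comm]
  simp only [GG_DD2, Finset.sum_sub_distrib]
  simp only [GG_DD]
  rw [h, Finset.mul_sum]
  have h3 : ∀ i : Fin N, DD (ee i) (fun p => f p.1) p * (-2 * ⟪p.1 - x₀, (ee i).1⟫ + (ee i).2)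
    = - (2 * (DD (ee i) (fun p => f p.1) p * ⟪p.1 - x₀, (ee i).1⟫)) := by
    intro i; simp only [ee]; ring
  simp only [h3, Finset.sum_neg_distrib]
  simp [tt]
  ring

end Bridge

section Max
variable {N : ℕ}

lemma GG_compact (x₀ : EuclideanSpace ℝ (Fin N)) {R : ℝ} (hR : 0 ≤ R) :
    IsCompact {p : EuclideanSpace ℝ (Fin N) × ℝ | 0 ≤ GG x₀ R p ∧ p.2 ≤ 0} := by
  have hK : IsCompact (closedBall x₀ R ×ˢ Icc (-R ^ 2) 0) :=
    (isCompact_closedBall x₀ R).prod isCompact_Icc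
  refine hK.of_isClosed_subset ?_ ?_
  · exact (isClosed_le continuous_const (GG_smooth x₀ R).continuous).inter
      (isClosed_le continuous_snd continuous_const)
  · rintro p ⟨h1, h2⟩
    unfold GG at h1
    have h3 := sq_nonneg ‖p.1 - x₀‖
    refine ⟨?_, ?_, h2⟩
    · rw [mem_closedBall, dist_eq_norm]
      exact abs_le_of_sq_le_sq' (by linarith) hR |>.2
    · linarith

lemma max_est {f : EuclideanSpace ℝ (Fin N) → ℝ} (hf : ContDiff ℝ (⊤ : ℕ∞) f)
    (hRic : ∀ x v, (0 : ℝ) ≤ hess f x v v) (x₀ : EuclideanSpace ℝ (Fin N))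
    {u : EuclideanSpace ℝ (Fin N) × ℝ → ℝ} (hu : ContDiff ℝ (⊤ : ℕ∞) u)
    (heq : ∀ p : EuclideanSpace ℝ (Fin N) × ℝ, p.2 ≤ 0 → LL (fun p => f p.1) u p = 0)
    {R M : ℝ} (hR : 0 ≤ R)
    (hM : ∀ p, 0 ≤ GG x₀ R p → p.2 ≤ 0 → u p * u p ≤ M)
    (p : EuclideanSpace ℝ (Fin N) × ℝ) (hp : 0 ≤ GG x₀ R p) (hp2 : p.2 ≤ 0) :
    GG x₀ R p * GG x₀ R p * ww u p
      ≤ (R ^ 2 * (1 + 2 * N + 2 * (‖fderiv ℝ f x₀‖ * R)) + 12 * R ^ 2 + 1) * M := by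
  set A : ℝ := 1 + 2 * N + 2 * (‖fderiv ℝ f x₀‖ * R) with hA
  have hA0 : 0 ≤ A := by positivity
  set B : ℝ := R ^ 2 * A + 12 * R ^ 2 + 1 with hB
  have hB0 : 0 ≤ B := by positivity
  set F : EuclideanSpace ℝ (Fin N) × ℝ → ℝ :=
    fun p => (GG x₀ R p * GG x₀ R p) * ww u p + B * (u p * u p) with hF
  have hFs : ContDiff ℝ (⊤ : ℕ∞) F :=
    (((GG_smooth x₀ R).mul (GG_smooth x₀ R)).mul (ww_smooth hu)).add
      (contDiff_const.mul (hu.mul hu))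
  obtain ⟨q, ⟨hq1, hq2⟩, hmax⟩ := (GG_compact x₀ hR).exists_isMaxOn ⟨p, hp, hp2⟩
    hFs.continuous.continuousOn
  have hpq : F p ≤ F q := hmax ⟨hp, hp2⟩
  have hBu : 0 ≤ B * (u p * u p) := mul_nonneg hB0 (mul_self_nonneg _)
  have hBq : B * (u q * u q) ≤ B * M := mul_le_mul_of_nonneg_left (hM q hq1 hq2) hB0
  suffices h : GG x₀ R q * GG x₀ R q * ww u q ≤ 0 by
    simp only [hF] at hpq
    linarith
  rcases hq1.eq_or_lt with h0 | hpos
  · rw [← h0]; simp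
  have hev : ∀ v : EuclideanSpace ℝ (Fin N) × ℝ, ∀ᶠ s : ℝ in 𝓝 0, 0 < GG x₀ R (q + s • v) := by
    intro v
    have hc : Continuous (fun s : ℝ => GG x₀ R (q + s • v)) :=
      (GG_smooth x₀ R).continuous.comp (by fun_prop)
    exact hc.continuousAt.eventually (lt_mem_nhds (by simpa using hpos))
  have hsp : ∀ i : Fin N, ∀ᶠ s : ℝ in 𝓝 0, F (q + s • ee i) ≤ F q := by
    intro i
    filter_upwards [hev (ee i)] with s hs
    exact hmax ⟨hs.le, by simpa [ee] using hq2⟩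
  have htm : ∀ᶠ s : ℝ in 𝓝[<] 0, F (q + s • tt) ≤ F q := by
    filter_upwards [nhdsWithin_le_nhds (hev tt), self_mem_nhdsWithin] with s hs hs0
    have hs0 : s < 0 := hs0
    exact hmax ⟨hs.le, by simp [tt]; linarith⟩
  have hLL : 0 ≤ LL (fun p => f p.1) F q := by
    unfold LL
    have h1 := DD_left hFs tt q htm
    have h2 : ∑ i, (DD (ee i) (DD (ee i) F) q - DD (ee i) (fun p => f p.1) q * DD (ee i) F q) ≤ 0 := by
      refine Finset.sum_nonpos fun i _ => ?_
      rw [DD_first hFs _ _ (hsp i)]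
      have := DD_second hFs _ _ (hsp i)
      linarith
    linarith
  have hle := main_ineq (lift_smooth hf) hu (GG_smooth x₀ R) q (conv_eq hf hRic q) (heq q hq2)
    (fun j => DD_zero_of_line (LL_smooth (lift_smooth hf) hu) _ _
      (fun s => heq _ (by simpa [ee] using hq2))) B
  have hρ : ‖q.1 - x₀‖ ^ 2 ≤ R ^ 2 := by
    have := hq1; unfold GG at this; linarith
  have hρ1 : ‖q.1 - x₀‖ ≤ R := abs_le_of_sq_le_sq' hρ hR |>.2
  have hGR : GG x₀ R q ≤ R ^ 2 := by
    unfold GG; nlinarith [sq_nonneg ‖q.1 - x₀‖]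
  have hLG : LL (fun p => f p.1) (GG x₀ R) q ≤ A := by
    rw [GG_LL hf]
    have h1 := grad_mono hf hRic x₀ q.1
    have h2 : |DD (q.1 - x₀) f x₀| ≤ ‖fderiv ℝ f x₀‖ * ‖q.1 - x₀‖ :=
      (fderiv ℝ f x₀).le_opNorm _
    have h3 : ‖fderiv ℝ f x₀‖ * ‖q.1 - x₀‖ ≤ ‖fderiv ℝ f x₀‖ * R := by gcongr
    have h4 := neg_abs_le (DD (q.1 - x₀) f x₀)
    linarith
  have hGL : GG x₀ R q * LL (fun p => f p.1) (GG x₀ R) q ≤ R ^ 2 * A :=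
    (mul_le_mul_of_nonneg_left hLG hq1).trans (mul_le_mul_of_nonneg_right hGR hA0)
  rw [GG_grad] at hle
  have hw0 := ww_nonneg (u := u) q
  have hfin : 2 * GG x₀ R q * LL (fun p => f p.1) (GG x₀ R) q + 6 * (4 * ‖q.1 - x₀‖ ^ 2) - 2 * B
      ≤ -2 := by
    rw [hB]; linarith
  have := mul_le_mul_of_nonneg_left hfin hw0
  have hw : ww u q = 0 := by linarith
  rw [hw]; simp

lemma growth_est (x₀ : EuclideanSpace ℝ (Fin N))
    (u : EuclideanSpace ℝ (Fin N) × ℝ → ℝ) (hu : Continuous u)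
    (hupos : ∀ p : EuclideanSpace ℝ (Fin N) × ℝ, p.2 ≤ 0 → 0 < u p)
    (hgrowth : Filter.Tendsto
      (fun p : EuclideanSpace ℝ (Fin N) × ℝ =>
        u p / (‖p.1 - x₀‖ ^ ((1 : ℝ) / 2) + |p.2| ^ ((1 : ℝ) / 4)))
      (ancientAtInfty x₀) (𝓝 0)) {δ : ℝ} (hδ : 0 < δ) :
    ∃ C : ℝ, 0 ≤ C ∧ ∀ R : ℝ, 0 ≤ R → ∀ p, 0 ≤ GG x₀ R p → p.2 ≤ 0 →
      u p * u p ≤ 4 * δ * R + C := by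
  have h1 := hgrowth.eventually (gt_mem_nhds (Real.sqrt_pos.2 hδ))
  unfold ancientAtInfty at h1
  rw [eventually_inf_principal, eventually_comap] at h1
  obtain ⟨S, hS⟩ := eventually_atTop.1 h1
  set S' := max S 1
  have hK : IsCompact (closedBall x₀ S' ×ˢ closedBall (0 : ℝ) S') :=
    (isCompact_closedBall _ _).prod (isCompact_closedBall _ _)
  obtain ⟨C, hC⟩ := hK.exists_bound_of_continuousOn (f := fun p => u p * u p)
    (by fun_prop)
  refine ⟨max C 0, le_max_right _ _, fun R hR p hp hp2 => ?_⟩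
  have hρ0 := norm_nonneg (p.1 - x₀)
  by_cases hsum : S' ≤ ‖p.1 - x₀‖ + |p.2|
  · have h2 := hS _ ((le_max_left _ _).trans hsum) p rfl hp2
    unfold GG at hp
    have hρ : ‖p.1 - x₀‖ ≤ R := abs_le_of_sq_le_sq' (by linarith) hR |>.2
    have ht : |p.2| ≤ R ^ 2 := by
      rw [abs_of_nonpos hp2]; nlinarith [sq_nonneg ‖p.1 - x₀‖]
    have e1 : ‖p.1 - x₀‖ ^ ((1 : ℝ) / 2) ≤ √R := by
      rw [Real.sqrt_eq_rpow]; gcongr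
    have e2 : |p.2| ^ ((1 : ℝ) / 4) ≤ √R := by
      have : √R = (R ^ 2) ^ ((1 : ℝ) / 4) := by
        rw [Real.sqrt_eq_rpow, ← Real.rpow_natCast, ← Real.rpow_mul hR]; norm_num
      rw [this]; gcongr
    have hpos : 0 < ‖p.1 - x₀‖ ^ ((1 : ℝ) / 2) + |p.2| ^ ((1 : ℝ) / 4) := by
      have h1 : 1 ≤ ‖p.1 - x₀‖ + |p.2| := (le_max_right _ _).trans hsum
      rcases hρ0.eq_or_lt with h0 | h0
      · have : 0 < |p.2| := by linarith
        positivity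
      · positivity
    rw [div_lt_iff₀ hpos] at h2
    have h3 : u p ≤ √δ * (2 * √R) := h2.le.trans (by gcongr; linarith)
    have h4 : u p * u p ≤ (√δ * (2 * √R)) * (√δ * (2 * √R)) :=
      mul_self_le_mul_self (hupos p hp2).le h3
    have h5 : (√δ * (2 * √R)) * (√δ * (2 * √R)) = 4 * δ * R := by
      have := Real.mul_self_sqrt hδ.le
      have := Real.mul_self_sqrt hR
      calc _ = 4 * (√δ * √δ) * (√R * √R) := by ring
        _ = _ := by simp [*]
    have := le_max_right C 0
    linarith
  · push Not at hsum
    have ha := abs_nonneg p.2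
    have h2 := hC p ⟨by rw [mem_closedBall, dist_eq_norm]; linarith,
      by rw [mem_closedBall, dist_zero_right, Real.norm_eq_abs]; linarith⟩
    have h3 := le_max_left C 0
    have h4 := (le_abs_self _).trans h2
    have : 0 ≤ 4 * δ * R := by positivity
    linarith

set_option maxHeartbeats 1000000 in
lemma ww_zero {f : EuclideanSpace ℝ (Fin N) → ℝ} (hf : ContDiff ℝ (⊤ : ℕ∞) f)
    (hRic : ∀ x v, (0 : ℝ) ≤ hess f x v v) (x₀ : EuclideanSpace ℝ (Fin N))
    {u : EuclideanSpace ℝ (Fin N) × ℝ → ℝ} (hu : ContDiff ℝ (⊤ : ℕ∞) u)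
    (hupos : ∀ p : EuclideanSpace ℝ (Fin N) × ℝ, p.2 ≤ 0 → 0 < u p)
    (heq : ∀ p : EuclideanSpace ℝ (Fin N) × ℝ, p.2 ≤ 0 → LL (fun p => f p.1) u p = 0)
    (hgrowth : Filter.Tendsto
      (fun p : EuclideanSpace ℝ (Fin N) × ℝ =>
        u p / (‖p.1 - x₀‖ ^ ((1 : ℝ) / 2) + |p.2| ^ ((1 : ℝ) / 4)))
      (ancientAtInfty x₀) (𝓝 0))
    (p : EuclideanSpace ℝ (Fin N) × ℝ) (hp2 : p.2 ≤ 0) : ww u p = 0 := by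
  by_contra hne
  have hw : 0 < ww u p := lt_of_le_of_ne (ww_nonneg p) (Ne.symm hne)
  set k := ‖fderiv ℝ f x₀‖ with hk
  set b : ℝ := 1 + 2 * N + 2 * k + 13 with hb
  have hb0 : 0 < b := by positivity
  set δ := ww u p / (40 * b) with hδd
  have hδ : 0 < δ := by positivity
  obtain ⟨C, hC0, hC⟩ := growth_est x₀ u hu.continuous hupos hgrowth hδ
  set c := ‖p.1 - x₀‖ ^ 2 - p.2 with hc
  have hc0 : 0 ≤ c := by nlinarith [sq_nonneg ‖p.1 - x₀‖]
  set R := 1 + 2 * c + C / δ with hRd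
  have hCδ : 0 ≤ C / δ := by positivity
  have hR1 : 1 ≤ R := by linarith
  have hR0 : 0 ≤ R := by linarith
  have hRc : 2 * c ≤ R ^ 2 := by nlinarith
  have hRC : C ≤ δ * R := by
    have : δ * (C / δ) = C := by field_simp
    nlinarith
  have hG : R ^ 2 / 2 ≤ GG x₀ R p := by
    unfold GG; linarith
  have hest := max_est hf hRic x₀ hu heq hR0 (hC R hR0) p (by nlinarith) hp2
  rw [← hk] at hest
  have hB : R ^ 2 * (1 + 2 * N + 2 * (k * R)) + 12 * R ^ 2 + 1 ≤ b * R ^ 3 := by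
    have h2 : R ^ 2 ≤ R ^ 3 := pow_le_pow_right₀ hR1 (by norm_num)
    have h3 : 1 ≤ R ^ 3 := one_le_pow₀ hR1
    have hN : (0 : ℝ) ≤ N := Nat.cast_nonneg N
    rw [hb]
    nlinarith
  have h1 : (R ^ 2 * (1 + 2 * N + 2 * (k * R)) + 12 * R ^ 2 + 1) * (4 * δ * R + C)
      ≤ (b * R ^ 3) * (5 * δ * R) := by
    apply mul_le_mul hB (by linarith) (by positivity) (by positivity)
  have h2 : (R ^ 2 / 2) * (R ^ 2 / 2) * ww u p ≤ GG x₀ R p * GG x₀ R p * ww u p := by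
    have h0 : 0 ≤ R ^ 2 / 2 := by positivity
    exact mul_le_mul_of_nonneg_right (mul_self_le_mul_self h0 hG) hw.le
  have h3 : b * δ = ww u p / 40 := by rw [hδd]; field_simp
  have h4 : (b * R ^ 3) * (5 * δ * R) = R ^ 4 * (ww u p / 8) := by
    calc _ = 5 * R ^ 4 * (b * δ) := by ring
      _ = _ := by rw [h3]; ring
  have h5 : 0 < R ^ 4 * ww u p := by positivity
  linarith

end Max

/-- **Theorem 1.2(2), Euclidean case.** Every positive ancient solution of the weighted heat
equation `∂ₜ u = Δ_f u` with `u(x,t) = o(|x−x₀|^{1/2} + |t|^{1/4})` near infinity is constant. -/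
theorem liouville_positive_ancient_weighted_heat (N : ℕ)
    (f : EuclideanSpace ℝ (Fin N) → ℝ) (hf : ContDiff ℝ (⊤ : ℕ∞) f)
    (hRic : ∀ x v, (0 : ℝ) ≤ hess f x v v)
    (x₀ : EuclideanSpace ℝ (Fin N))
    (u : EuclideanSpace ℝ (Fin N) × ℝ → ℝ) (hu : ContDiff ℝ (⊤ : ℕ∞) u)
    (hupos : ∀ p : EuclideanSpace ℝ (Fin N) × ℝ, p.2 ≤ 0 → 0 < u p)
    (heq : ∀ p : EuclideanSpace ℝ (Fin N) × ℝ, p.2 ≤ 0 → tderiv u p = swlap f u p)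
    (hgrowth : Filter.Tendsto
      (fun p : EuclideanSpace ℝ (Fin N) × ℝ =>
        u p / (‖p.1 - x₀‖ ^ ((1 : ℝ) / 2) + |p.2| ^ ((1 : ℝ) / 4)))
      (ancientAtInfty x₀) (𝓝 0)) :
    ∀ p p' : EuclideanSpace ℝ (Fin N) × ℝ, p.2 ≤ 0 → p'.2 ≤ 0 → u p = u p' := by
  have heq' : ∀ p : EuclideanSpace ℝ (Fin N) × ℝ, p.2 ≤ 0 → LL (fun p => f p.1) u p = 0 := by
    intro p hp
    rw [LL_eq hf hu, heq p hp, sub_self]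
  have hw := ww_zero hf hRic x₀ hu hupos heq' hgrowth
  have hX : ∀ p : EuclideanSpace ℝ (Fin N) × ℝ, p.2 ≤ 0 → ∀ i, DD (ee i) u p = 0 := by
    intro p hp i
    have h := (Finset.sum_eq_zero_iff_of_nonneg
      (fun j _ => mul_self_nonneg (DD (ee j) u p))).1 (hw p hp) i (Finset.mem_univ i)
    exact mul_self_eq_zero.1 h
  have hT : ∀ p : EuclideanSpace ℝ (Fin N) × ℝ, p.2 ≤ 0 → DD tt u p = 0 := by
    intro p hp
    have h := heq' p hp
    unfold LL at h
    rw [Finset.sum_eq_zero, sub_zero] at h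
    · exact h
    intro i _
    rw [hX p hp, DD_zero_of_line (DD_smooth hu _) _ _ (fun s => hX _ (by simpa [ee] using hp) i)]
    simp
  have hD : ∀ p : EuclideanSpace ℝ (Fin N) × ℝ, p.2 ≤ 0 → fderiv ℝ u p = 0 := by
    intro p hp
    ext1
    · apply ContinuousLinearMap.coe_injective
      refine (EuclideanSpace.basisFun (Fin N) ℝ).toBasis.ext fun i => ?_
      simpa [DD, ee] using hX p hp i
    · ext1
      simpa [DD, tt] using hT p hp
  intro p p' hp hp'
  have hconv : Convex ℝ {p : EuclideanSpace ℝ (Fin N) × ℝ | p.2 ≤ 0} :=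
    convex_halfSpace_le (f := Prod.snd) ⟨fun _ _ => rfl, fun _ _ => rfl⟩ 0
  have := hconv.norm_image_sub_le_of_norm_hasFDerivWithin_le (f := u) (C := 0)
    (fun x _ => (sm_diff hu x).hasFDerivAt.hasFDerivWithinAt)
    (fun x hx => by rw [hD x hx]; simp) hp' hp
  rw [zero_mul] at this
  exact sub_eq_zero.1 (norm_le_zero_iff.1 this)
end
end
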